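/- Let 1 ≤ p < 4 and 1 ≤ q < ∞ be real numbers and let φ₀ be a dyadic partition function. For Schwartz functions f, g : ℝ² → ℂ define, for ξ ≠ 0, B̂[f,g](ξ) := (1/2) ∫_{ℝ²} (ξ·η^⊥)(ξ·(2η−ξ)) / (‖ξ‖² (‖η‖+‖ξ−η‖) ‖ξ−η‖ ‖η‖) · f̂(ξ−η) ĝ(η) dη (the integral converges absolutely), and for j ∈ ℤ set Δ_j B[f,g](x) := (2π)^{−2} ∫_{ℝ²} e^{i x·ξ} φ̂₀(2^{−j}ξ) B̂[f,g](ξ) dξ. Then there exists a constant C > 0, depending only on p, q and φ₀, such that for all Schwartz f, g, ( Σ_{j∈ℤ} ( 2^{(2/p − 1)j} ‖Δ_j B[f,g]‖_{L^p(ℝ²)} )^q )^{1/q} ≤ C ( Σ_{j∈ℤ} ( 2^{(2/p − 1)j} ‖φ_j ∗ f‖_{L^p(ℝ²)} )^q )^{1/q} · ( Σ_{j∈ℤ} ( 2^{(2/p − 1)j} ‖φ_j ∗ g‖_{L^p(ℝ²)} )^q )^{1/q}. -/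

import Mathlib

open MeasureTheory Complex
open scoped RealInnerProductSpace ENNReal NNReal

noncomputable section

abbrev E2 : Type := EuclideanSpace ℝ (Fin 2)

/-- Rotation by 90 degrees: `η^⊥ = (-η₂, η₁)`. -/
def perp (η : E2) : E2 := (WithLp.equiv 2 (Fin 2 → ℝ)).symm ![-η 1, η 0]

/-- The first standard basis vector `e₁ = (1,0)`. -/
def e1 : E2 := EuclideanSpace.single 0 1

/-- The unit vector `a = (1/√2, 1/√2)`. -/
def aVec : E2 := (WithLp.equiv 2 (Fin 2 → ℝ)).symm ![1 / Real.sqrt 2, 1 / Real.sqrt 2]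

/-- Fourier transform `ĥ(ξ) = ∫ e^{-i x·ξ} h(x) dx`. -/
def FT (h : E2 → ℂ) (ξ : E2) : ℂ :=
  ∫ x : E2, Complex.exp (-(Complex.I * ((⟪x, ξ⟫ : ℝ) : ℂ))) * h x

/-- A dyadic partition function: a Schwartz function `φ₀` together with its
(real-valued) Fourier transform `Φ` satisfying the standard Littlewood--Paley
conditions. -/
structure DyadicData where
  φ : SchwartzMap E2 ℂ
  Φ : E2 → ℝ
  hFT : ∀ ξ : E2, FT (fun x => φ x) ξ = ((Φ ξ : ℝ) : ℂ)
  h0 : ∀ ξ : E2, 0 ≤ Φ ξ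
  h1 : ∀ ξ : E2, Φ ξ ≤ 1
  hsupp : ∀ ξ : E2, Φ ξ ≠ 0 → 1 / 2 ≤ ‖ξ‖ ∧ ‖ξ‖ ≤ 2
  hone : ∀ ξ : E2, 7 / 8 ≤ ‖ξ‖ → ‖ξ‖ ≤ 5 / 4 → Φ ξ = 1
  hsum : ∀ ξ : E2, ξ ≠ 0 → HasSum (fun k : ℤ => Φ ((2 : ℝ) ^ (-k) • ξ)) 1

/-- `ψ̂_j(ξ) = 1 − Σ_{k ≥ j−10} φ̂₀(2^{−k}(ξ − 2^j a))`. -/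
def psiHat (D : DyadicData) (j : ℤ) (ξ : E2) : ℝ :=
  1 - ∑' k : ℕ, D.Φ ((2 : ℝ) ^ (-(j - 10 + (k : ℤ))) • (ξ - (2 : ℝ) ^ j • aVec))

/-- The symbol-side bilinear form `B̂[f,g](ξ)` of the quasi-geostrophic
nonlinearity in double-divergence form. -/
def BHat (f g : SchwartzMap E2 ℂ) (ξ : E2) : ℂ :=
  (1 / 2 : ℂ) *
    ∫ η : E2, ((⟪ξ, perp η⟫ * ⟪ξ, (2 : ℝ) • η - ξ⟫ /
        (‖ξ‖ ^ 2 * (‖η‖ + ‖ξ - η‖) * ‖ξ - η‖ * ‖η‖) : ℝ) : ℂ) *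
      FT (fun x => f x) (ξ - η) * FT (fun x => g x) η

/-- The Littlewood--Paley piece
`Δ_j B[f,g](x) = (2π)^{−2} ∫ e^{ix·ξ} φ̂₀(2^{−j}ξ) B̂[f,g](ξ) dξ`. -/
def DeltaB (D : DyadicData) (f g : SchwartzMap E2 ℂ) (j : ℤ) (x : E2) : ℂ :=
  (((2 * Real.pi) ^ 2 : ℝ) : ℂ)⁻¹ *
    ∫ ξ : E2, Complex.exp (Complex.I * ((⟪x, ξ⟫ : ℝ) : ℂ)) *
      ((D.Φ ((2 : ℝ) ^ (-j) • ξ) : ℝ) : ℂ) * BHat f g ξ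

/-- The convolution `(φ_j ∗ f)(x)` with `φ_j = 2^{2j} φ₀(2^j ·)`. -/
def convPhi (D : DyadicData) (j : ℤ) (f : E2 → ℂ) (x : E2) : ℂ :=
  ∫ y : E2, (((2 : ℝ) ^ (2 * j) : ℝ) : ℂ) * D.φ ((2 : ℝ) ^ j • y) * f (x - y)

/-- Jensen's inequality for the weighted `lintegral`. -/
theorem lintegral_mul_rpow_le {α : Type*} [MeasurableSpace α] (μ : Measure α) {p : ℝ}
    (hp : 1 ≤ p) {w f : α → ℝ≥0∞} (hw : Measurable w) (hf : Measurable f) :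
    (∫⁻ a, w a * f a ∂μ) ^ p ≤ (∫⁻ a, w a ∂μ) ^ (p - 1) * ∫⁻ a, w a * f a ^ p ∂μ := by
  rcases hp.eq_or_lt with rfl | hp
  · simp
  have hp0 : 0 < p := by linarith
  have hpq := (Real.HolderConjugate.conjExponent hp)
  set q := p.conjExponent with hq
  have hq0 : 0 < q := hpq.symm.pos
  have h := ENNReal.lintegral_mul_le_Lp_mul_Lq μ hpq.symm
    (f := fun a => w a ^ (1 / q)) (g := fun a => w a ^ (1 / p) * f a)
    (by fun_prop) (by fun_prop)
  have e1 : ∀ a, ((fun a => w a ^ (1 / q)) * (fun a => w a ^ (1 / p) * f a)) a = w a * f a := by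
    intro a
    simp only [Pi.mul_apply]
    rw [← mul_assoc, ← ENNReal.rpow_add_of_nonneg _ _ (by positivity) (by positivity)]
    have : 1 / q + 1 / p = 1 := by
      have := hpq.symm.inv_add_inv_eq_one
      simpa [one_div] using this
    rw [this, ENNReal.rpow_one]
  have e2 : ∀ a, (w a ^ (1 / q)) ^ q = w a := by
    intro a
    rw [← ENNReal.rpow_mul, one_div_mul_cancel hq0.ne', ENNReal.rpow_one]
  have e3 : ∀ a, (w a ^ (1 / p) * f a) ^ p = w a * f a ^ p := by
    intro a
    rw [ENNReal.mul_rpow_of_nonneg _ _ hp0.le, ← ENNReal.rpow_mul,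
      one_div_mul_cancel hp0.ne', ENNReal.rpow_one]
  simp only [e1, e2, e3] at h
  calc (∫⁻ a, w a * f a ∂μ) ^ p
      ≤ ((∫⁻ a, w a ∂μ) ^ (1 / q) * (∫⁻ a, w a * f a ^ p ∂μ) ^ (1 / p)) ^ p := by gcongr
    _ = _ := by
      rw [ENNReal.mul_rpow_of_nonneg _ _ hp0.le, ← ENNReal.rpow_mul, ← ENNReal.rpow_mul,
        one_div_mul_cancel hp0.ne', ENNReal.rpow_one]
      congr 2
      rw [hq, Real.conjExponent]
      field_simp

/-- The `L^p` norm of a nonnegative function. -/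
def lpNorm' (p : ℝ) (F : E2 → ℝ≥0∞) : ℝ≥0∞ := (∫⁻ x, F x ^ p) ^ (1 / p)

/-- An integrable weight on the plane. -/
def wt (y : E2) : ℝ≥0∞ := ENNReal.ofReal ((1 + ‖y‖) ^ (-3 : ℝ))

/-- Weighted averages at scale `2^{-j}`. -/
def avg (j : ℤ) (F : E2 → ℝ≥0∞) (x : E2) : ℝ≥0∞ :=
  ∫⁻ y, wt y * F (x - (2 : ℝ) ^ (-j) • y)

theorem measurable_wt : Measurable wt := by
  unfold wt; fun_prop

theorem wt_le_one (y : E2) : wt y ≤ 1 := by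
  unfold wt
  rw [ENNReal.ofReal_le_one]
  exact Real.rpow_le_one_of_one_le_of_nonpos (by linarith [norm_nonneg y]) (by norm_num)

theorem lintegral_wt_ne_top : ∫⁻ y, wt y ≠ ⊤ := by
  refine (finite_integral_one_add_norm (E := E2) (μ := volume) (r := 3) ?_).ne
  simp; norm_num

theorem measurable_avg (j : ℤ) {F : E2 → ℝ≥0∞} (hF : Measurable F) : Measurable (avg j F) := by
  have h1 := measurable_wt
  unfold avg
  exact Measurable.lintegral_prod_right' (f := fun z : E2 × E2 =>
    wt z.2 * F (z.1 - (2 : ℝ) ^ (-j) • z.2)) (by fun_prop)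

theorem two_zpow_eq_rpow (j : ℤ) : ENNReal.ofReal ((2 : ℝ) ^ j) = (2 : ℝ≥0∞) ^ (j : ℝ) := by
  rw [← Real.rpow_intCast, ← ENNReal.ofReal_rpow_of_pos two_pos]
  simp

theorem lintegral_comp_sub_smul (j : ℤ) (F : E2 → ℝ≥0∞) (x : E2) :
    ∫⁻ y, F (x - (2 : ℝ) ^ (-j) • y) = (2 : ℝ≥0∞) ^ (2 * (j : ℝ)) * ∫⁻ y, F y := by
  have hc : (2 : ℝ) ^ (-j) ≠ 0 := by positivity
  have h := lintegral_map_equiv (μ := (volume : Measure E2)) (fun y => F (x - y))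
    (Homeomorph.smul (Units.mk0 _ hc)).toMeasurableEquiv
  have h' : Measure.map (Homeomorph.smul (α := E2) (Units.mk0 _ hc)).toMeasurableEquiv volume =
      ENNReal.ofReal |(((2 : ℝ) ^ (-j)) ^ Module.finrank ℝ E2)⁻¹| • volume :=
    Measure.map_addHaar_smul (volume : Measure E2) hc
  rw [h', lintegral_smul_measure, lintegral_sub_left_eq_self (fun y => F y) x] at h
  refine h.symm.trans ?_
  rw [smul_eq_mul]
  congr 1
  have : (2 : ℝ) * (j : ℝ) = ((2 * j : ℤ) : ℝ) := by push_cast; ring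
  rw [this, ← two_zpow_eq_rpow]
  congr 1
  rw [abs_of_nonneg (by positivity)]
  simp only [zpow_neg, finrank_euclideanSpace, Fintype.card_fin, inv_pow, inv_inv]
  rw [← zpow_natCast, ← zpow_mul, mul_comm]
  rfl

theorem avg_rpow_le {p : ℝ} (hp : 1 ≤ p) (j : ℤ) {F : E2 → ℝ≥0∞} (hF : Measurable F) (x : E2) :
    avg j F x ^ p ≤ (∫⁻ y, wt y) ^ (p - 1) * avg j (fun y => F y ^ p) x :=
  lintegral_mul_rpow_le volume hp measurable_wt (by fun_prop)

theorem avg_le_lpNorm' {p : ℝ} (hp : 1 ≤ p) (j : ℤ) {F : E2 → ℝ≥0∞} (hF : Measurable F)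
    (x : E2) : avg j F x ≤
      (∫⁻ y, wt y) ^ ((p - 1) / p) * (2 : ℝ≥0∞) ^ (2 / p * (j : ℝ)) * lpNorm' p F := by
  have hp0 : 0 < p := by linarith
  rw [← ENNReal.rpow_le_rpow_iff hp0]
  refine (avg_rpow_le hp j hF x).trans ?_
  have h : avg j (fun y => F y ^ p) x ≤ (2 : ℝ≥0∞) ^ (2 * (j : ℝ)) * ∫⁻ y, F y ^ p := by
    rw [← lintegral_comp_sub_smul j (fun y => F y ^ p) x]
    exact lintegral_mono fun y => mul_le_of_le_one_left zero_le (wt_le_one y)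
  rw [ENNReal.mul_rpow_of_nonneg _ _ hp0.le, ENNReal.mul_rpow_of_nonneg _ _ hp0.le, lpNorm',
    ← ENNReal.rpow_mul, ← ENNReal.rpow_mul, ← ENNReal.rpow_mul, div_mul_cancel₀ _ hp0.ne',
    one_div_mul_cancel hp0.ne', ENNReal.rpow_one, mul_assoc]
  have : 2 / p * (j : ℝ) * p = 2 * j := by field_simp
  rw [this]
  gcongr

theorem lintegral_avg (j : ℤ) {F : E2 → ℝ≥0∞} (hF : Measurable F) :
    ∫⁻ x, avg j F x = (∫⁻ y, wt y) * ∫⁻ y, F y := by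
  have h1 := measurable_wt
  unfold avg
  rw [lintegral_lintegral_swap (by fun_prop)]
  rw [← lintegral_mul_const _ h1]
  refine lintegral_congr fun y => ?_
  rw [lintegral_const_mul _ (by fun_prop), lintegral_sub_right_eq_self (fun y => F y)]

theorem lintegral_avg_rpow_le {p : ℝ} (hp : 1 ≤ p) (j : ℤ) {F : E2 → ℝ≥0∞} (hF : Measurable F) :
    ∫⁻ x, avg j F x ^ p ≤ (∫⁻ y, wt y) ^ p * ∫⁻ y, F y ^ p := by
  calc ∫⁻ x, avg j F x ^ p
      ≤ ∫⁻ x, (∫⁻ y, wt y) ^ (p - 1) * avg j (fun y => F y ^ p) x :=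
        lintegral_mono fun x => avg_rpow_le hp j hF x
    _ = (∫⁻ y, wt y) ^ (p - 1) * ((∫⁻ y, wt y) ^ (1 : ℝ) * ∫⁻ y, F y ^ p) := by
        rw [lintegral_const_mul _ (measurable_avg j (by fun_prop)), lintegral_avg j (by fun_prop),
          ENNReal.rpow_one]
    _ = _ := by
        rw [← mul_assoc, ← ENNReal.rpow_add_of_nonneg _ _ (by linarith) (by norm_num)]
        congr 2; ring

/-- Young's (Bernstein's) inequality for the averages. -/
theorem exists_lpNorm'_avg_le {p r : ℝ} (hp : 1 ≤ p) (hpr : p ≤ r) :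
    ∃ C : ℝ≥0∞, C ≠ ⊤ ∧ ∀ (j : ℤ) (F : E2 → ℝ≥0∞), Measurable F →
      lpNorm' r (avg j F) ≤ C * (2 : ℝ≥0∞) ^ (2 * (1 / p - 1 / r) * (j : ℝ)) * lpNorm' p F := by
  have hp0 : 0 < p := by linarith
  have hr0 : 0 < r := by linarith
  set W : ℝ≥0∞ := ∫⁻ y, wt y with hW
  have hWt : W ≠ ⊤ := lintegral_wt_ne_top
  have hs : 0 ≤ (r - p) / r := div_nonneg (by linarith) hr0.le
  refine ⟨(W ^ ((p - 1) / p)) ^ ((r - p) / r) * W ^ (p / r), ?_, ?_⟩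
  · exact ENNReal.mul_ne_top (ENNReal.rpow_ne_top_of_nonneg hs (ENNReal.rpow_ne_top_of_nonneg
      (div_nonneg (by linarith) hp0.le) hWt)) (ENNReal.rpow_ne_top_of_nonneg (by positivity) hWt)
  intro j F hF
  have hm := measurable_avg j hF
  set S : ℝ≥0∞ := W ^ ((p - 1) / p) * (2 : ℝ≥0∞) ^ (2 / p * (j : ℝ)) * lpNorm' p F with hS
  have h1 : ∫⁻ x, avg j F x ^ r ≤ S ^ (r - p) * (W ^ p * ∫⁻ y, F y ^ p) := by
    calc ∫⁻ x, avg j F x ^ r ≤ ∫⁻ x, S ^ (r - p) * avg j F x ^ p := by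
          refine lintegral_mono fun x => ?_
          have : avg j F x ^ r = avg j F x ^ (r - p) * avg j F x ^ p := by
            rw [← ENNReal.rpow_add_of_nonneg _ _ (by linarith) hp0.le]; congr 1; ring
          rw [this]
          gcongr
          exact avg_le_lpNorm' hp j hF x
      _ = S ^ (r - p) * ∫⁻ x, avg j F x ^ p := lintegral_const_mul _ (by fun_prop)
      _ ≤ _ := by gcongr; exact lintegral_avg_rpow_le hp j hF
  have hI : ∫⁻ y, F y ^ p = lpNorm' p F ^ p := by
    rw [lpNorm', ← ENNReal.rpow_mul, one_div_mul_cancel hp0.ne', ENNReal.rpow_one]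
  rw [hI] at h1
  have h2 : lpNorm' r (avg j F) ≤ S ^ ((r - p) / r) * (W ^ (p / r) * lpNorm' p F ^ (p / r)) := by
    rw [lpNorm']
    refine (ENNReal.rpow_le_rpow h1 (by positivity)).trans (le_of_eq ?_)
    rw [ENNReal.mul_rpow_of_nonneg (S ^ (r - p)) _ (by positivity),
      ENNReal.mul_rpow_of_nonneg (W ^ p) _ (by positivity), ← ENNReal.rpow_mul, ← ENNReal.rpow_mul,
        ← ENNReal.rpow_mul, mul_one_div, mul_one_div]
  refine h2.trans (le_of_eq ?_)
  have hN : lpNorm' p F = lpNorm' p F ^ ((r - p) / r) * lpNorm' p F ^ (p / r) := by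
    rw [← ENNReal.rpow_add_of_nonneg _ _ hs (by positivity)]
    have : (r - p) / r + p / r = 1 := by field_simp; ring
    rw [this, ENNReal.rpow_one]
  have e : (2 : ℝ≥0∞) ^ (2 * (1 / p - 1 / r) * (j : ℝ)) =
      ((2 : ℝ≥0∞) ^ (2 / p * (j : ℝ))) ^ ((r - p) / r) := by
    rw [← ENNReal.rpow_mul]; congr 1; field_simp
  rw [hS, ENNReal.mul_rpow_of_nonneg _ _ hs, ENNReal.mul_rpow_of_nonneg _ _ hs, e]
  conv_rhs => rw [hN]
  ring

theorem lpNorm'_mono {p : ℝ} (hp : 0 < p) {F G : E2 → ℝ≥0∞} (h : ∀ x, F x ≤ G x) :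
    lpNorm' p F ≤ lpNorm' p G := by
  unfold lpNorm'
  gcongr with x
  exact h x

theorem lpNorm'_const_mul {p : ℝ} (hp : 0 < p) (c : ℝ≥0∞) {F : E2 → ℝ≥0∞} (hF : Measurable F) :
    lpNorm' p (fun x => c * F x) = c * lpNorm' p F := by
  unfold lpNorm'
  simp_rw [ENNReal.mul_rpow_of_nonneg _ _ hp.le]
  rw [lintegral_const_mul _ (by fun_prop), ENNReal.mul_rpow_of_nonneg _ _ (by positivity),
    ← ENNReal.rpow_mul, mul_one_div_cancel hp.ne', ENNReal.rpow_one]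

theorem lpNorm'_mul_le {r : ℝ} (hr : 0 < r) {F G : E2 → ℝ≥0∞} (hF : Measurable F)
    (hG : Measurable G) :
    lpNorm' (r / 2) (fun x => F x * G x) ≤ lpNorm' r F * lpNorm' r G := by
  have h := ENNReal.lintegral_mul_le_Lp_mul_Lq volume Real.HolderConjugate.two_two
    (f := fun x => F x ^ (r / 2)) (g := fun x => G x ^ (r / 2)) (by fun_prop) (by fun_prop)
  simp only [Pi.mul_apply, ← ENNReal.rpow_mul, div_mul_cancel₀ r (two_ne_zero' ℝ)] at h
  unfold lpNorm'
  simp_rw [ENNReal.mul_rpow_of_nonneg _ _ (by positivity : 0 ≤ r / 2)]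
  refine (ENNReal.rpow_le_rpow h (by positivity)).trans (le_of_eq ?_)
  have : 1 / 2 * (1 / (r / 2)) = 1 / r := by field_simp
  rw [ENNReal.mul_rpow_of_nonneg _ _ (by positivity), ← ENNReal.rpow_mul, ← ENNReal.rpow_mul, this]

theorem lpNorm'_sum_le {p : ℝ} (hp : 1 ≤ p) {ι : Type*} (s : Finset ι) {F : ι → E2 → ℝ≥0∞}
    (hF : ∀ i, Measurable (F i)) :
    lpNorm' p (fun x => ∑ i ∈ s, F i x) ≤ ∑ i ∈ s, lpNorm' p (F i) := by
  classical
  induction s using Finset.induction_on with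
  | empty =>
    have hp0 : 0 < p := by linarith
    simp [lpNorm', hp0]
  | insert a s ha ih =>
    simp_rw [Finset.sum_insert ha]
    refine le_trans ?_ (add_le_add_right ih _)
    exact ENNReal.lintegral_Lp_add_le (hF a).aemeasurable
      (Finset.measurable_fun_sum s fun i _ => hF i).aemeasurable hp

theorem lpNorm'_tsum_le {p : ℝ} (hp : 1 ≤ p) {ι : Type*} [Countable ι] {F : ι → E2 → ℝ≥0∞}
    (hF : ∀ i, Measurable (F i)) :
    lpNorm' p (fun x => ∑' i, F i x) ≤ ∑' i, lpNorm' p (F i) := by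
  have hp0 : 0 < p := by linarith
  have e : ∀ x, (∑' i, F i x) ^ p = ⨆ s : Finset ι, (∑ i ∈ s, F i x) ^ p := by
    intro x
    rw [ENNReal.tsum_eq_iSup_sum]
    exact (ENNReal.orderIsoRpow p hp0).map_iSup _
  have e2 : lpNorm' p (fun x => ∑' i, F i x) =
      ⨆ s : Finset ι, lpNorm' p (fun x => ∑ i ∈ s, F i x) := by
    unfold lpNorm'
    simp_rw [e]
    rw [lintegral_iSup_directed]
    · exact (ENNReal.orderIsoRpow (1 / p) (by positivity)).map_iSup _
    · intro s
      exact ((Finset.measurable_fun_sum s fun i _ => hF i).pow_const p).aemeasurable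
    · refine Monotone.directed_le fun s t hst x => ?_
      dsimp only
      gcongr
  rw [e2]
  exact iSup_le fun s => (lpNorm'_sum_le hp s hF).trans (ENNReal.sum_le_tsum s)

/-- Young's inequality for convolution with a summable kernel on `ℤ`. -/
theorem tsum_conv_rpow_le {q : ℝ} (hq : 1 ≤ q) (κ b : ℤ → ℝ≥0∞) :
    ∑' j, (∑' l, κ (l - j) * b l) ^ q ≤ (∑' n, κ n) ^ q * ∑' l, b l ^ q := by
  have h1 : ∀ j, (∑' l, κ (l - j) * b l) ^ q ≤
      (∑' n, κ n) ^ (q - 1) * ∑' l, κ (l - j) * b l ^ q := by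
    intro j
    have h := lintegral_mul_rpow_le (Measure.count : Measure ℤ) hq
      (w := fun l => κ (l - j)) (f := b) (measurable_of_countable _) (measurable_of_countable _)
    simp only [lintegral_count] at h
    rwa [show ∑' l, κ (l - j) = ∑' n, κ n from (Equiv.subRight j).tsum_eq κ] at h
  calc ∑' j, (∑' l, κ (l - j) * b l) ^ q
      ≤ ∑' j, (∑' n, κ n) ^ (q - 1) * ∑' l, κ (l - j) * b l ^ q := ENNReal.tsum_le_tsum h1
    _ = (∑' n, κ n) ^ (q - 1) * ((∑' n, κ n) ^ (1 : ℝ) * ∑' l, b l ^ q) := by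
        rw [ENNReal.tsum_mul_left, ENNReal.tsum_comm]
        congr 1
        rw [ENNReal.rpow_one, ← ENNReal.tsum_mul_left]
        refine tsum_congr fun l => ?_
        rw [ENNReal.tsum_mul_right, show ∑' j, κ (l - j) = ∑' n, κ n from (Equiv.subLeft l).tsum_eq κ]
    _ = _ := by
        rw [← mul_assoc, ← ENNReal.rpow_add_of_nonneg _ _ (by linarith) (by norm_num)]
        congr 2; ring

open scoped FourierTransform SchwartzMap ContDiff

/-- The unimodular phase `e^{it}`. -/
def phase (t : ℝ) : ℂ := Complex.exp (Complex.I * (t : ℂ))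

theorem norm_phase (t : ℝ) : ‖phase t‖ = 1 := by
  rw [phase, mul_comm, Complex.norm_exp_ofReal_mul_I]

@[fun_prop]
theorem continuous_phase : Continuous phase := by unfold phase; fun_prop

theorem phase_add (s t : ℝ) : phase (s + t) = phase s * phase t := by
  rw [phase, phase, phase, ← Complex.exp_add]; push_cast; ring_nf

theorem phase_neg_eq (t : ℝ) : Complex.exp (-(Complex.I * (t : ℂ))) = phase (-t) := by
  rw [phase]; push_cast; ring_nf

section Representation

variable {V : Type*} [NormedAddCommGroup V] [InnerProductSpace ℝ V] [FiniteDimensional ℝ V]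
  [MeasurableSpace V] [BorelSpace V]

theorem integral_phase_neg_eq_fourier (f : V → ℂ) (ξ : V) :
    ∫ x, phase (-⟪x, ξ⟫) * f x = 𝓕 f ((2 * Real.pi)⁻¹ • ξ) := by
  rw [Real.fourier_eq']
  refine integral_congr_ae (Filter.Eventually.of_forall fun x => ?_)
  simp only [phase, smul_eq_mul, real_inner_smul_right]
  congr 2
  have : (Real.pi : ℂ) ≠ 0 := by exact_mod_cast Real.pi_ne_zero
  push_cast
  field_simp

theorem exists_schwartz_kernel {h : V → ℂ} (h1 : HasCompactSupport h) (h2 : ContDiff ℝ ∞ h) :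
    ∃ H : 𝓢(V, ℂ), ∀ ξ, h ξ = ∫ y, phase (-⟪y, ξ⟫) * H y := by
  have hc : (2 * Real.pi : ℝ) ≠ 0 := by positivity
  let g : V → ℂ := fun ξ => h ((2 * Real.pi) • ξ)
  have g1 : HasCompactSupport g := h1.comp_homeomorph (Homeomorph.smulOfNeZero _ hc)
  have g2 : ContDiff ℝ ∞ g := h2.comp (by fun_prop)
  let G : 𝓢(V, ℂ) := g1.toSchwartzMap g2
  refine ⟨𝓕⁻ G, fun ξ => ?_⟩
  rw [integral_phase_neg_eq_fourier, ← SchwartzMap.fourier_coe, FourierTransform.fourier_fourierInv_eq]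
  show h ξ = h ((2 * Real.pi) • (2 * Real.pi)⁻¹ • ξ)
  rw [smul_inv_smul₀ hc]

end Representation

theorem exists_norm_le_one_add_norm {V : Type*} [NormedAddCommGroup V]
    [NormedSpace ℝ V] (H : 𝓢(V, ℂ)) (k : ℕ) :
    ∃ C : ℝ, 0 ≤ C ∧ ∀ y, (1 + ‖y‖) ^ k * ‖H y‖ ≤ C := by
  have h := SchwartzMap.one_add_le_sup_seminorm_apply (𝕜 := ℝ) (m := (k, 0)) (k := k) (n := 0)
    le_rfl le_rfl H
  simp only [norm_iteratedFDeriv_zero] at h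
  exact ⟨_, (by positivity : (0 : ℝ) ≤ (1 + ‖(0 : V)‖) ^ k * ‖H 0‖).trans (h 0), h⟩

theorem norm_le_of_pow_mul_le {a b C : ℝ} (ha : 0 ≤ a) (h : (1 + a) ^ 3 * b ≤ C) :
    b ≤ C * (1 + a) ^ (-3 : ℝ) := by
  have h1 : 0 < 1 + a := by linarith
  have : (1 + a) ^ (-3 : ℝ) = ((1 + a) ^ 3)⁻¹ := by
    rw [Real.rpow_neg h1.le]; norm_cast
  rw [this, ← div_eq_mul_inv, le_div_iff₀ (by positivity)]
  linarith

/-- `h` is the Fourier transform of a continuous kernel with cubic decay. -/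
def IsMult (h : E2 → ℂ) : Prop :=
  ∃ (H : E2 → ℂ) (C : ℝ), Continuous H ∧ 0 ≤ C ∧
    (∀ y, ‖H y‖ ≤ C * (1 + ‖y‖) ^ (-3 : ℝ)) ∧ ∀ ξ, h ξ = ∫ y, phase (-⟪y, ξ⟫) * H y

/-- `M` is the Fourier transform of a continuous kernel with cubic decay in each variable. -/
def IsBiMult (M : E2 → E2 → ℂ) : Prop :=
  ∃ (K : E2 × E2 → ℂ) (C : ℝ), Continuous K ∧ 0 ≤ C ∧
    (∀ z, ‖K z‖ ≤ C * ((1 + ‖z.1‖) ^ (-3 : ℝ) * (1 + ‖z.2‖) ^ (-3 : ℝ))) ∧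
    ∀ ζ η, M ζ η = ∫ z : E2 × E2, phase (-(⟪z.1, ζ⟫ + ⟪z.2, η⟫)) * K z

theorem isMult_of_contDiff {h : E2 → ℂ} (h1 : HasCompactSupport h) (h2 : ContDiff ℝ ∞ h) :
    IsMult h := by
  obtain ⟨H, hH⟩ := exists_schwartz_kernel h1 h2
  obtain ⟨C, hC0, hC⟩ := exists_norm_le_one_add_norm H 3
  exact ⟨H, C, H.continuous, hC0, fun y => norm_le_of_pow_mul_le (norm_nonneg _) (hC y), hH⟩

theorem isBiMult_of_contDiff {M : E2 → E2 → ℂ} {R : ℝ}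
    (h1 : ∀ ζ η, M ζ η ≠ 0 → ‖ζ‖ ≤ R ∧ ‖η‖ ≤ R)
    (h2 : ContDiff ℝ ∞ (fun z : E2 × E2 => M z.1 z.2)) : IsBiMult M := by
  let g : WithLp 2 (E2 × E2) → ℂ := fun z => M z.fst z.snd
  have g2 : ContDiff ℝ ∞ g := by
    have : ContDiff ℝ ∞ (fun z : WithLp 2 (E2 × E2) => (z.fst, z.snd)) :=
      (WithLp.prodContinuousLinearEquiv 2 ℝ E2 E2).contDiff
    exact h2.comp this
  have g1 : HasCompactSupport g := by
    have hK : IsCompact ((WithLp.prodContinuousLinearEquiv 2 ℝ E2 E2).symm ''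
        (Metric.closedBall (0 : E2) R ×ˢ Metric.closedBall (0 : E2) R)) :=
      ((isCompact_closedBall _ _).prod (isCompact_closedBall _ _)).image
        (WithLp.prodContinuousLinearEquiv 2 ℝ E2 E2).symm.continuous
    refine HasCompactSupport.intro hK fun z hz => ?_
    by_contra h0
    obtain ⟨ha, hb⟩ := h1 _ _ h0
    exact hz ⟨(z.fst, z.snd), by simpa using ⟨ha, hb⟩, rfl⟩
  obtain ⟨H, hH⟩ := exists_schwartz_kernel g1 g2
  obtain ⟨C, hC0, hC⟩ := exists_norm_le_one_add_norm H 6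
  refine ⟨fun z => H (WithLp.toLp 2 z), C,
    H.continuous.comp (WithLp.prodContinuousLinearEquiv 2 ℝ E2 E2).symm.continuous, hC0, ?_, ?_⟩
  · intro z
    have hz := hC (WithLp.toLp 2 z)
    have n1 : ‖z.1‖ ≤ ‖WithLp.toLp 2 z‖ := by
      rw [WithLp.prod_norm_eq_of_L2]
      exact Real.le_sqrt_of_sq_le (by simp)
    have n2 : ‖z.2‖ ≤ ‖WithLp.toLp 2 z‖ := by
      rw [WithLp.prod_norm_eq_of_L2]
      exact Real.le_sqrt_of_sq_le (by simp)
    rw [← mul_assoc]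
    refine norm_le_of_pow_mul_le (norm_nonneg _) (norm_le_of_pow_mul_le (norm_nonneg _) ?_)
    refine le_trans ?_ hz
    rw [← mul_assoc, show 6 = 3 + 3 from rfl, pow_add (1 + ‖WithLp.toLp 2 z‖)]
    gcongr
  · intro ζ η
    have := hH (WithLp.toLp 2 (ζ, η))
    rw [← (WithLp.volume_preserving_toLp E2 E2).integral_comp
      (WithLp.homeomorphProd 2 E2 E2).symm.measurableEmbedding] at this
    simpa [g] using this

theorem FT_eq_fourier (f : 𝓢(E2, ℂ)) (ξ : E2) :
    FT (fun x => f x) ξ = (𝓕 f : 𝓢(E2, ℂ)) ((2 * Real.pi)⁻¹ • ξ) := by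
  rw [SchwartzMap.fourier_coe, ← integral_phase_neg_eq_fourier]
  simp only [FT, phase_neg_eq]

theorem contDiff_FT (f : 𝓢(E2, ℂ)) : ContDiff ℝ ∞ (FT (fun x => f x)) := by
  have : FT (fun x => f x) = fun ξ => (𝓕 f : 𝓢(E2, ℂ)) ((2 * Real.pi)⁻¹ • ξ) :=
    funext (FT_eq_fourier f)
  rw [this]
  exact ((𝓕 f : 𝓢(E2, ℂ)).smooth _).comp (by fun_prop)

theorem integrable_FT (f : 𝓢(E2, ℂ)) : Integrable (FT (fun x => f x)) := by
  have : FT (fun x => f x) = fun ξ => (𝓕 f : 𝓢(E2, ℂ)) ((2 * Real.pi)⁻¹ • ξ) :=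
    funext (FT_eq_fourier f)
  rw [this]
  exact (𝓕 f : 𝓢(E2, ℂ)).integrable.comp_smul (by positivity)

theorem FT_inversion (f : 𝓢(E2, ℂ)) (x : E2) :
    f x = (((2 * Real.pi) ^ 2 : ℝ) : ℂ)⁻¹ * ∫ ζ, phase ⟪x, ζ⟫ * FT (fun x => f x) ζ := by
  have h1 : f x = ∫ w, phase (2 * Real.pi * ⟪x, w⟫) * (𝓕 f : 𝓢(E2, ℂ)) w := by
    conv_lhs => rw [← FourierTransform.fourierInv_fourier_eq (F := 𝓢(E2, ℂ)) f]
    rw [SchwartzMap.fourierInv_coe, Real.fourierInv_eq']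
    refine integral_congr_ae (Filter.Eventually.of_forall fun w => ?_)
    simp only [phase, smul_eq_mul, real_inner_comm]
    congr 2
    rw [mul_comm, real_inner_comm]
  have h2 := Measure.integral_comp_smul (volume : Measure E2)
    (fun w => phase (2 * Real.pi * ⟪x, w⟫) * (𝓕 f : 𝓢(E2, ℂ)) w) ((2 * Real.pi)⁻¹)
  rw [← h1] at h2
  have h3 : ∀ ζ, phase ⟪x, ζ⟫ * FT (fun x => f x) ζ =
      phase (2 * Real.pi * ⟪x, (2 * Real.pi)⁻¹ • ζ⟫) * (𝓕 f : 𝓢(E2, ℂ)) ((2 * Real.pi)⁻¹ • ζ) := by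
    intro ζ
    rw [FT_eq_fourier, real_inner_smul_right, mul_inv_cancel_left₀ (by positivity)]
  simp_rw [h3]
  rw [h2]
  have e : |(((2 * Real.pi)⁻¹ ^ Module.finrank ℝ E2)⁻¹ : ℝ)| = (2 * Real.pi) ^ 2 := by
    simp only [finrank_euclideanSpace, Fintype.card_fin, inv_pow, inv_inv]
    exact abs_of_nonneg (by positivity)
  rw [e, Complex.real_smul, inv_mul_cancel_left₀]
  exact_mod_cast (by positivity : (2 * Real.pi) ^ 2 ≠ 0)

/-- Fubini's theorem for integrals with a bounded factor. -/
theorem integral_phase_swap {X Y : Type*} [MeasurableSpace X] [MeasurableSpace Y]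
    {μ : Measure X} {ν : Measure Y} [SFinite μ] [SFinite ν] {K : X → ℂ} {u : Y → ℂ}
    {e : X → Y → ℂ} (hK : Integrable K μ) (hu : Integrable u ν)
    (he : Measurable (Function.uncurry e)) (he1 : ∀ x y, ‖e x y‖ ≤ 1) :
    ∫ y, (∫ x, e x y * K x ∂μ) * u y ∂ν = ∫ x, K x * ∫ y, e x y * u y ∂ν ∂μ := by
  have hKu : Integrable (Function.uncurry fun x y => e x y * (K x * u y)) (μ.prod ν) :=
    (hK.mul_prod hu).bdd_mul he.aestronglyMeasurable (c := 1)
      (Filter.Eventually.of_forall fun z => he1 z.1 z.2)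
  calc ∫ y, (∫ x, e x y * K x ∂μ) * u y ∂ν = ∫ y, ∫ x, e x y * (K x * u y) ∂μ ∂ν := by
        refine integral_congr_ae (Filter.Eventually.of_forall fun y => ?_)
        simp only [← integral_mul_const, mul_assoc]
    _ = ∫ x, ∫ y, e x y * (K x * u y) ∂ν ∂μ := (integral_integral_swap hKu).symm
    _ = _ := by
        refine integral_congr_ae (Filter.Eventually.of_forall fun x => ?_)
        simp only [← integral_const_mul]
        refine integral_congr_ae (Filter.Eventually.of_forall fun y => ?_)
        simp only
        ring

theorem FT_dilate (φ : E2 → ℂ) (k : ℤ) (ζ : E2) :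
    ∫ y : E2, phase (-⟪y, ζ⟫) * ((((2 : ℝ) ^ (2 * k) : ℝ) : ℂ) * φ ((2 : ℝ) ^ k • y)) =
      FT φ ((2 : ℝ) ^ (-k) • ζ) := by
  have h := Measure.integral_comp_smul (volume : Measure E2)
    (fun y => phase (-⟪y, (2 : ℝ) ^ (-k) • ζ⟫) * φ y) ((2 : ℝ) ^ k)
  have e : ∀ y : E2, phase (-⟪y, ζ⟫) * ((((2 : ℝ) ^ (2 * k) : ℝ) : ℂ) * φ ((2 : ℝ) ^ k • y)) =
      (((2 : ℝ) ^ (2 * k) : ℝ) : ℂ) *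
        (phase (-⟪(2 : ℝ) ^ k • y, (2 : ℝ) ^ (-k) • ζ⟫) * φ ((2 : ℝ) ^ k • y)) := by
    intro y
    rw [real_inner_smul_left, real_inner_smul_right, zpow_neg, mul_inv_cancel_left₀ (by positivity)]
    ring
  simp_rw [e]
  rw [integral_const_mul, h, Complex.real_smul, ← mul_assoc, ← Complex.ofReal_mul]
  have e2 : (2 : ℝ) ^ (2 * k) * |(((2 : ℝ) ^ k) ^ Module.finrank ℝ E2)⁻¹| = 1 := by
    rw [abs_of_nonneg (by positivity)]
    simp only [finrank_euclideanSpace, Fintype.card_fin]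
    rw [← zpow_natCast, ← zpow_mul, mul_comm k]
    exact mul_inv_cancel₀ (by positivity)
  rw [e2]
  simp only [FT, phase_neg_eq, Complex.ofReal_one, one_mul]

/-- The frequency-localized Fourier transform. -/
def locFT (D : DyadicData) (k : ℤ) (f : SchwartzMap E2 ℂ) (ζ : E2) : ℂ :=
  (D.Φ ((2 : ℝ) ^ (-k) • ζ) : ℂ) * FT (fun x => f x) ζ

theorem contDiff_Φ (D : DyadicData) : ContDiff ℝ ∞ (fun ξ => (D.Φ ξ : ℂ)) := by
  have : (fun ξ => (D.Φ ξ : ℂ)) = FT (fun x => D.φ x) := funext fun ξ => (D.hFT ξ).symm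
  rw [this]
  exact contDiff_FT _

theorem continuous_Φ (D : DyadicData) : Continuous D.Φ := by
  have := (contDiff_Φ D).continuous
  exact (Complex.continuous_re.comp this)

theorem norm_Φ_le (D : DyadicData) (ξ : E2) : ‖(D.Φ ξ : ℂ)‖ ≤ 1 := by
  rw [Complex.norm_real, Real.norm_of_nonneg (D.h0 _)]
  exact D.h1 _

theorem integrable_locFT (D : DyadicData) (k : ℤ) (f : SchwartzMap E2 ℂ) :
    Integrable (locFT D k f) := by
  have h := continuous_Φ D
  exact (integrable_FT f).bdd_mul (c := 1)
    (by fun_prop) (Filter.Eventually.of_forall fun z => norm_Φ_le D _)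

theorem convPhi_eq (D : DyadicData) (k : ℤ) (f : SchwartzMap E2 ℂ) (x : E2) :
    convPhi D k (fun x => f x) x =
      (((2 * Real.pi) ^ 2 : ℝ) : ℂ)⁻¹ * ∫ ζ, phase ⟪x, ζ⟫ * locFT D k f ζ := by
  set c : ℂ := (((2 * Real.pi) ^ 2 : ℝ) : ℂ)⁻¹
  set ψ : E2 → ℂ := fun y => (((2 : ℝ) ^ (2 * k) : ℝ) : ℂ) * D.φ ((2 : ℝ) ^ k • y) with hψ
  have hψi : Integrable ψ := (D.φ.integrable.comp_smul (by positivity)).const_mul _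
  have hs := integral_phase_swap (μ := volume) (ν := volume) (K := ψ)
    (u := fun ζ => phase ⟪x, ζ⟫ * FT (fun x => f x) ζ)
    (e := fun y ζ => phase (-⟪y, ζ⟫)) hψi
    ((integrable_FT f).bdd_mul (c := 1) (by fun_prop)
      (Filter.Eventually.of_forall fun z => (norm_phase _).le))
    (by fun_prop) (fun _ _ => (norm_phase _).le)
  have e1 : ∀ ζ, (∫ y, phase (-⟪y, ζ⟫) * ψ y) * (phase ⟪x, ζ⟫ * FT (fun x => f x) ζ) =
      phase ⟪x, ζ⟫ * locFT D k f ζ := by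
    intro ζ
    rw [hψ, FT_dilate (fun y => D.φ y) k ζ, D.hFT, locFT]
    ring
  simp_rw [e1] at hs
  rw [hs, ← integral_const_mul, convPhi]
  refine integral_congr_ae (Filter.Eventually.of_forall fun y => ?_)
  simp only
  rw [FT_inversion f (x - y)]
  have e2 : ∀ ζ, phase ⟪x - y, ζ⟫ * FT (fun x => f x) ζ =
      phase (-⟪y, ζ⟫) * (phase ⟪x, ζ⟫ * FT (fun x => f x) ζ) := by
    intro ζ
    rw [← mul_assoc, ← phase_add, inner_sub_left]; ring_nf
  simp_rw [e2]
  ring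

theorem continuous_convPhi (D : DyadicData) (k : ℤ) (f : SchwartzMap E2 ℂ) :
    Continuous (convPhi D k (fun x => f x)) := by
  have : convPhi D k (fun x => f x) = fun x =>
      (((2 * Real.pi) ^ 2 : ℝ) : ℂ)⁻¹ * ∫ ζ, phase ⟪x, ζ⟫ * locFT D k f ζ :=
    funext (convPhi_eq D k f)
  rw [this]
  refine continuous_const.mul ?_
  refine continuous_of_dominated (bound := fun ζ => ‖locFT D k f ζ‖) ?_ ?_
    (integrable_locFT D k f).norm ?_
  · intro x
    exact (by fun_prop : AEStronglyMeasurable (fun ζ : E2 => phase ⟪x, ζ⟫) volume).mul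
      (integrable_locFT D k f).aestronglyMeasurable
  · intro x
    exact Filter.Eventually.of_forall fun ζ => by rw [norm_mul, norm_phase, one_mul]
  · exact Filter.Eventually.of_forall fun ζ => by fun_prop

theorem integrable_wt : Integrable (fun y : E2 => (1 + ‖y‖) ^ (-3 : ℝ)) :=
  integrable_one_add_norm (by simp; norm_num)

theorem enorm_le_wt {a : ℂ} {C : ℝ} {y : E2} (hC : 0 ≤ C)
    (h : ‖a‖ ≤ C * (1 + ‖y‖) ^ (-3 : ℝ)) : ‖a‖ₑ ≤ ENNReal.ofReal C * wt y := by
  rw [wt, ← ENNReal.ofReal_mul hC, ← ofReal_norm]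
  exact ENNReal.ofReal_le_ofReal h

theorem enorm_le_wt_mul_wt {a : ℂ} {C : ℝ} {y z : E2} (hC : 0 ≤ C)
    (h : ‖a‖ ≤ C * ((1 + ‖y‖) ^ (-3 : ℝ) * (1 + ‖z‖) ^ (-3 : ℝ))) :
    ‖a‖ₑ ≤ ENNReal.ofReal C * (wt y * wt z) := by
  rw [wt, wt, ← ENNReal.ofReal_mul (by positivity), ← ENNReal.ofReal_mul hC,
    ← ofReal_norm]
  exact ENNReal.ofReal_le_ofReal h

/-- The inverse Fourier transform, without normalization. -/
def invFT (u : E2 → ℂ) (x : E2) : ℂ := ∫ ζ, phase ⟪x, ζ⟫ * u ζ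

theorem integrable_phase_mul {X : Type*} [MeasurableSpace X] {μ : Measure X} {u : X → ℂ}
    (hu : Integrable u μ) {a : X → ℝ} (ha : Measurable a) :
    Integrable (fun z => phase (a z) * u z) μ :=
  hu.bdd_mul (c := 1) (continuous_phase.measurable.comp ha).aestronglyMeasurable
    (Filter.Eventually.of_forall fun _ => (norm_phase _).le)

theorem continuous_invFT {u : E2 → ℂ} (hu : Integrable u) : Continuous (invFT u) := by
  refine continuous_of_dominated (bound := fun ζ => ‖u ζ‖) ?_ ?_ hu.norm ?_
  · exact fun x => (integrable_phase_mul hu (by fun_prop)).aestronglyMeasurable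
  · exact fun x => Filter.Eventually.of_forall fun ζ => by rw [norm_mul, norm_phase, one_mul]
  · exact Filter.Eventually.of_forall fun ζ => by fun_prop

theorem bimult_identity {K : E2 × E2 → ℂ} (hK : Integrable K) {M : E2 → E2 → ℂ}
    (hM : ∀ ζ η, M ζ η = ∫ z : E2 × E2, phase (-(⟪z.1, ζ⟫ + ⟪z.2, η⟫)) * K z)
    (a b : ℝ) {u v : E2 → ℂ} (hu : Integrable u) (hv : Integrable v) (x : E2) :
    ∫ z : E2 × E2, M (a • z.1) (b • z.2) * (phase ⟪x, z.1 + z.2⟫ * (u z.1 * v z.2)) =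
      ∫ w : E2 × E2, K w * (invFT u (x - a • w.1) * invFT v (x - b • w.2)) := by
  have hs := integral_phase_swap (K := K)
    (u := fun z : E2 × E2 => phase ⟪x, z.1 + z.2⟫ * (u z.1 * v z.2))
    (e := fun w z : E2 × E2 => phase (-(⟪w.1, a • z.1⟫ + ⟪w.2, b • z.2⟫))) hK
    (integrable_phase_mul (hu.mul_prod hv) (by fun_prop)) (by fun_prop)
    (fun _ _ => (norm_phase _).le)
  simp_rw [hM]
  refine hs.trans (integral_congr_ae (Filter.Eventually.of_forall fun w => ?_))
  simp only
  congr 1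
  rw [invFT, invFT, ← integral_prod_mul]
  refine integral_congr_ae (Filter.Eventually.of_forall fun z => ?_)
  simp only
  have : phase (-(⟪w.1, a • z.1⟫ + ⟪w.2, b • z.2⟫)) * phase ⟪x, z.1 + z.2⟫ =
      phase ⟪x - a • w.1, z.1⟫ * phase ⟪x - b • w.2, z.2⟫ := by
    rw [← phase_add, ← phase_add]
    congr 1
    simp only [inner_sub_left, inner_add_right, real_inner_smul_left, real_inner_smul_right]
    ring
  rw [← mul_assoc, this]
  ring

theorem enorm_bimult_le {K : E2 × E2 → ℂ} {C : ℝ} (hC : 0 ≤ C)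
    (hKb : ∀ z, ‖K z‖ ≤ C * ((1 + ‖z.1‖) ^ (-3 : ℝ) * (1 + ‖z.2‖) ^ (-3 : ℝ)))
    (k l : ℤ) {F G : E2 → ℂ} (hF : Continuous F) (hG : Continuous G) (x : E2) :
    ‖∫ w : E2 × E2, K w * (F (x - (2 : ℝ) ^ (-k) • w.1) * G (x - (2 : ℝ) ^ (-l) • w.2))‖ₑ ≤
      ENNReal.ofReal C * (avg k (fun y => ‖F y‖ₑ) x * avg l (fun y => ‖G y‖ₑ) x) := by
  have hw := measurable_wt
  have hFm := hF.measurable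
  have hGm := hG.measurable
  refine (enorm_integral_le_lintegral_enorm _).trans ?_
  have h1 : avg k (fun y => ‖F y‖ₑ) x * avg l (fun y => ‖G y‖ₑ) x =
      ∫⁻ w : E2 × E2, (wt w.1 * ‖F (x - (2 : ℝ) ^ (-k) • w.1)‖ₑ) *
        (wt w.2 * ‖G (x - (2 : ℝ) ^ (-l) • w.2)‖ₑ) := by
    exact (lintegral_prod_mul (f := fun y => wt y * ‖F (x - (2 : ℝ) ^ (-k) • y)‖ₑ)
      (g := fun y => wt y * ‖G (x - (2 : ℝ) ^ (-l) • y)‖ₑ) (by fun_prop) (by fun_prop)).symm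
  rw [h1, ← lintegral_const_mul _ (by fun_prop)]
  refine lintegral_mono fun w => ?_
  simp only [enorm_mul]
  calc _ ≤ (ENNReal.ofReal C * (wt w.1 * wt w.2)) * (‖F (x - (2 : ℝ) ^ (-k) • w.1)‖ₑ *
        ‖G (x - (2 : ℝ) ^ (-l) • w.2)‖ₑ) := by
        gcongr
        exact enorm_le_wt_mul_wt hC (hKb w)
    _ = _ := by ring

/-- A bilinear multiplier with symbol `h(ζ+η) M(ζ,η)` is dominated by weighted averages at the
corresponding scales. -/
theorem exists_bilinear_bound {h : E2 → ℂ} {M : E2 → E2 → ℂ} (hh : IsMult h)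
    (hM : IsBiMult M) :
    ∃ C : ℝ≥0∞, C ≠ ⊤ ∧ ∀ (j k l : ℤ) (u v : E2 → ℂ), Integrable u → Integrable v → ∀ x : E2,
      Integrable (fun z : E2 × E2 => h ((2 : ℝ) ^ (-j) • (z.1 + z.2)) *
          (M ((2 : ℝ) ^ (-k) • z.1) ((2 : ℝ) ^ (-l) • z.2) *
            (phase ⟪x, z.1 + z.2⟫ * (u z.1 * v z.2)))) ∧
      ‖∫ z : E2 × E2, h ((2 : ℝ) ^ (-j) • (z.1 + z.2)) *
          (M ((2 : ℝ) ^ (-k) • z.1) ((2 : ℝ) ^ (-l) • z.2) *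
            (phase ⟪x, z.1 + z.2⟫ * (u z.1 * v z.2)))‖ₑ ≤
        C * avg j (fun y => avg k (fun y => ‖invFT u y‖ₑ) y *
          avg l (fun y => ‖invFT v y‖ₑ) y) x := by
  obtain ⟨H, C1, hHc, hC1, hHb, hH⟩ := hh
  obtain ⟨K, C2, hKc, hC2, hKb, hM⟩ := hM
  have hw := measurable_wt
  refine ⟨ENNReal.ofReal C1 * ENNReal.ofReal C2, by finiteness, ?_⟩
  intro j k l u v hu hv x
  have hHi : Integrable H := (integrable_wt.const_mul C1).mono' hHc.aestronglyMeasurable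
    (Filter.Eventually.of_forall hHb)
  have hKi : Integrable K := ((integrable_wt.mul_prod integrable_wt).const_mul C2).mono'
    hKc.aestronglyMeasurable (Filter.Eventually.of_forall hKb)
  have hFc := continuous_invFT hu
  have hGc := continuous_invFT hv
  have hMm : Measurable (fun z : E2 × E2 => M ((2 : ℝ) ^ (-k) • z.1) ((2 : ℝ) ^ (-l) • z.2)) := by
    simp_rw [hM]
    refine StronglyMeasurable.measurable (StronglyMeasurable.integral_prod_right
      (f := fun (z : E2 × E2) (w : E2 × E2) =>
        phase (-(⟪w.1, (2 : ℝ) ^ (-k) • z.1⟫ + ⟪w.2, (2 : ℝ) ^ (-l) • z.2⟫)) * K w) ?_)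
    exact Continuous.stronglyMeasurable (by fun_prop)
  have hMb : ∀ z : E2 × E2, ‖M ((2 : ℝ) ^ (-k) • z.1) ((2 : ℝ) ^ (-l) • z.2)‖ ≤
      ∫ w, ‖K w‖ := by
    intro z
    rw [hM]
    refine (norm_integral_le_integral_norm _).trans (le_of_eq ?_)
    simp only [norm_mul, norm_phase, one_mul]
  have hhm : Measurable (fun z : E2 × E2 => h ((2 : ℝ) ^ (-j) • (z.1 + z.2))) := by
    simp_rw [hH]
    refine StronglyMeasurable.measurable (StronglyMeasurable.integral_prod_right
      (f := fun (z : E2 × E2) (y : E2) => phase (-⟪y, (2 : ℝ) ^ (-j) • (z.1 + z.2)⟫) * H y) ?_)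
    exact Continuous.stronglyMeasurable (by fun_prop)
  have hhb : ∀ z : E2 × E2, ‖h ((2 : ℝ) ^ (-j) • (z.1 + z.2))‖ ≤ ∫ y, ‖H y‖ := by
    intro z
    rw [hH]
    refine (norm_integral_le_integral_norm _).trans (le_of_eq ?_)
    simp only [norm_mul, norm_phase, one_mul]
  have hMi := (integrable_phase_mul (hu.mul_prod hv) (a := fun z : E2 × E2 => ⟪x, z.1 + z.2⟫)
    (by fun_prop)).bdd_mul hMm.aestronglyMeasurable (Filter.Eventually.of_forall hMb)
  refine ⟨hMi.bdd_mul hhm.aestronglyMeasurable (Filter.Eventually.of_forall hhb), ?_⟩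
  have hs := integral_phase_swap (K := H)
    (u := fun z : E2 × E2 => M ((2 : ℝ) ^ (-k) • z.1) ((2 : ℝ) ^ (-l) • z.2) *
      (phase ⟪x, z.1 + z.2⟫ * (u z.1 * v z.2)))
    (e := fun (y : E2) (z : E2 × E2) => phase (-⟪y, (2 : ℝ) ^ (-j) • (z.1 + z.2)⟫)) hHi
    hMi (by fun_prop) (fun _ _ => (norm_phase _).le)
  have e1 : ∀ y : E2, ∫ z : E2 × E2, phase (-⟪y, (2 : ℝ) ^ (-j) • (z.1 + z.2)⟫) *
      (M ((2 : ℝ) ^ (-k) • z.1) ((2 : ℝ) ^ (-l) • z.2) *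
        (phase ⟪x, z.1 + z.2⟫ * (u z.1 * v z.2))) =
      ∫ w : E2 × E2, K w * (invFT u ((x - (2 : ℝ) ^ (-j) • y) - (2 : ℝ) ^ (-k) • w.1) *
        invFT v ((x - (2 : ℝ) ^ (-j) • y) - (2 : ℝ) ^ (-l) • w.2)) := by
    intro y
    rw [← bimult_identity hKi hM _ _ hu hv]
    refine integral_congr_ae (Filter.Eventually.of_forall fun z => ?_)
    simp only
    rw [inner_sub_left, sub_eq_neg_add, phase_add, real_inner_smul_left, real_inner_smul_right]
    ring
  have key : ∫ z : E2 × E2, h ((2 : ℝ) ^ (-j) • (z.1 + z.2)) *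
      (M ((2 : ℝ) ^ (-k) • z.1) ((2 : ℝ) ^ (-l) • z.2) *
        (phase ⟪x, z.1 + z.2⟫ * (u z.1 * v z.2))) =
      ∫ y, H y * ∫ w : E2 × E2, K w *
        (invFT u ((x - (2 : ℝ) ^ (-j) • y) - (2 : ℝ) ^ (-k) • w.1) *
          invFT v ((x - (2 : ℝ) ^ (-j) • y) - (2 : ℝ) ^ (-l) • w.2)) := by
    simp_rw [hH]
    refine hs.trans (integral_congr_ae (Filter.Eventually.of_forall fun y => ?_))
    exact congrArg (H y * ·) (e1 y)
  rw [key]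
  refine (enorm_integral_le_lintegral_enorm _).trans ?_
  unfold avg
  rw [← lintegral_const_mul]
  · refine lintegral_mono fun y => ?_
    rw [enorm_mul]
    refine (mul_le_mul' (enorm_le_wt hC1 (hHb y))
      (enorm_bimult_le hC2 hKb k l hFc hGc _)).trans (le_of_eq ?_)
    unfold avg
    ring
  · have m1 := measurable_avg k (F := fun y => ‖invFT u y‖ₑ) (by fun_prop)
    have m2 := measurable_avg l (F := fun y => ‖invFT v y‖ₑ) (by fun_prop)
    unfold avg at m1 m2
    exact measurable_wt.mul ((m1.comp (by fun_prop)).mul (m2.comp (by fun_prop)))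

theorem exists_bilinear_sum_bound {ι : Type*} [Fintype ι] {h : ι → E2 → ℂ}
    {M : ι → E2 → E2 → ℂ} (hh : ∀ i, IsMult (h i)) (hM : ∀ i, IsBiMult (M i)) :
    ∃ C : ℝ≥0∞, C ≠ ⊤ ∧ ∀ (j k l : ℤ) (u v : E2 → ℂ), Integrable u → Integrable v →
      ∀ (x : E2) (c : ι → ℂ) (B : ℝ≥0∞), (∀ i, ‖c i‖ₑ ≤ B) →
      ‖∫ z : E2 × E2, (∑ i, c i * (h i ((2 : ℝ) ^ (-j) • (z.1 + z.2)) *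
          M i ((2 : ℝ) ^ (-k) • z.1) ((2 : ℝ) ^ (-l) • z.2))) *
            (phase ⟪x, z.1 + z.2⟫ * (u z.1 * v z.2))‖ₑ ≤
        C * B * avg j (fun y => avg k (fun y => ‖invFT u y‖ₑ) y *
          avg l (fun y => ‖invFT v y‖ₑ) y) x := by
  choose C hC hb using fun i => exists_bilinear_bound (hh i) (hM i)
  refine ⟨∑ i, C i, by simp [hC], ?_⟩
  intro j k l u v hu hv x c B hc
  have e : ∀ z : E2 × E2, (∑ i, c i * (h i ((2 : ℝ) ^ (-j) • (z.1 + z.2)) *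
          M i ((2 : ℝ) ^ (-k) • z.1) ((2 : ℝ) ^ (-l) • z.2))) *
            (phase ⟪x, z.1 + z.2⟫ * (u z.1 * v z.2)) =
      ∑ i, c i * (h i ((2 : ℝ) ^ (-j) • (z.1 + z.2)) *
          (M i ((2 : ℝ) ^ (-k) • z.1) ((2 : ℝ) ^ (-l) • z.2) *
            (phase ⟪x, z.1 + z.2⟫ * (u z.1 * v z.2)))) := by
    intro z
    rw [Finset.sum_mul]
    exact Finset.sum_congr rfl fun i _ => by ring
  simp_rw [e]
  rw [integral_finsetSum _ fun i _ => (hb i j k l u v hu hv x).1.const_mul _,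
    Finset.sum_mul, Finset.sum_mul]
  refine (enorm_sum_le _ _).trans (Finset.sum_le_sum fun i _ => ?_)
  rw [integral_const_mul, enorm_mul, mul_comm (C i), mul_assoc B]
  exact mul_le_mul' (hc i) (hb i j k l u v hu hv x).2

theorem perp_zero (η : E2) : perp η 0 = -η 1 := rfl

theorem perp_one (η : E2) : perp η 1 = η 0 := rfl

theorem inner_eq (x y : E2) : (⟪x, y⟫ : ℝ) = x 0 * y 0 + x 1 * y 1 := by
  simp [PiLp.inner_apply, Fin.sum_univ_two]
  ring

/-- A smooth function equal to `1` near the origin and vanishing for `‖ζ‖ ≥ 1/16`. -/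
def originBump : ContDiffBump (0 : E2) := ⟨1 / 32, 1 / 16, by norm_num, by norm_num⟩

/-- A smooth compactly supported function equal to `1` for `‖ζ‖ ≤ 16`. -/
def wideBump : ContDiffBump (0 : E2) := ⟨16, 32, by norm_num, by norm_num⟩

/-- A smooth positive function equal to the norm outside the ball of radius `1/16`. -/
def regNorm (ζ : E2) : ℝ := Real.sqrt (‖ζ‖ ^ 2 + originBump ζ)

theorem regNorm_arg_pos (ζ : E2) : 0 < ‖ζ‖ ^ 2 + originBump ζ := by
  rcases eq_or_ne ζ 0 with rfl | h
  · have : originBump (0 : E2) = 1 :=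
      originBump.one_of_mem_closedBall (by simp [originBump])
    simp [this]
  · have := originBump.nonneg (x := ζ)
    positivity

theorem regNorm_pos (ζ : E2) : 0 < regNorm ζ := Real.sqrt_pos.2 (regNorm_arg_pos ζ)

theorem regNorm_eq {ζ : E2} (h : 1 / 16 ≤ ‖ζ‖) : regNorm ζ = ‖ζ‖ := by
  have : originBump ζ = 0 := originBump.zero_of_le_dist (by simpa [originBump] using h)
  rw [regNorm, this, add_zero, Real.sqrt_sq (norm_nonneg _)]

@[fun_prop]
theorem contDiff_regNorm : ContDiff ℝ ∞ regNorm :=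
  ContDiff.sqrt (((contDiff_norm_sq ℝ)).add originBump.contDiff)
    fun ζ => (regNorm_arg_pos ζ).ne'

@[fun_prop]
theorem contDiff_wideBump : ContDiff ℝ ∞ wideBump := wideBump.contDiff

theorem wideBump_eq_one {ζ : E2} (h : ‖ζ‖ ≤ 16) : wideBump ζ = 1 :=
  wideBump.one_of_mem_closedBall (by simpa [wideBump] using h)

theorem norm_le_of_wideBump_ne_zero {ζ : E2} (h : wideBump ζ ≠ 0) : ‖ζ‖ ≤ 32 := by
  by_contra! h'
  exact h (wideBump.zero_of_le_dist (by simpa [wideBump] using h'.le))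

@[fun_prop]
theorem contDiff_coord (i : Fin 2) : ContDiff ℝ ∞ (fun ζ : E2 => ζ i) :=
  (EuclideanSpace.proj (𝕜 := ℝ) i).contDiff

theorem contDiff_perp_coord (i : Fin 2) : ContDiff ℝ ∞ (fun ζ : E2 => perp ζ i) := by
  fin_cases i
  · exact (contDiff_coord 1).neg
  · exact contDiff_coord 0

theorem contDiff_ofReal' {V : Type*} [NormedAddCommGroup V] [NormedSpace ℝ V] {f : V → ℝ}
    (hf : ContDiff ℝ ∞ f) : ContDiff ℝ ∞ (fun x => (f x : ℂ)) :=
  Complex.ofRealCLM.contDiff.comp hf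

/-- A smooth symbol localized by `Φ` is a multiplier. -/
theorem isMult_Φ_mul (D : DyadicData) {a : E2 → ℝ} (ha : ContDiff ℝ ∞ a) :
    IsMult (fun ξ => ((D.Φ ξ * a ξ : ℝ) : ℂ)) := by
  refine isMult_of_contDiff ?_ ?_
  · refine HasCompactSupport.intro (isCompact_closedBall (0 : E2) 2) fun ξ hξ => ?_
    have : D.Φ ξ = 0 := by
      by_contra h
      exact hξ (by simpa using (D.hsupp ξ h).2)
    simp [this]
  · simp only [Complex.ofReal_mul]
    exact (contDiff_Φ D).mul (contDiff_ofReal' ha)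

theorem isBiMult_wideBump_mul {a : E2 × E2 → ℝ} (ha : ContDiff ℝ ∞ a) :
    IsBiMult (fun ζ η => ((a (ζ, η) * (wideBump ζ * wideBump η) : ℝ) : ℂ)) := by
  refine isBiMult_of_contDiff (R := 32) (fun ζ η h => ?_) ?_
  · have h' : a (ζ, η) * (wideBump ζ * wideBump η) ≠ 0 := by exact_mod_cast h
    exact ⟨norm_le_of_wideBump_ne_zero (left_ne_zero_of_mul (right_ne_zero_of_mul h')),
      norm_le_of_wideBump_ne_zero (right_ne_zero_of_mul (right_ne_zero_of_mul h'))⟩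
  · refine contDiff_ofReal' (ha.mul ?_)
    exact (contDiff_wideBump.comp contDiff_fst).mul (contDiff_wideBump.comp contDiff_snd)

/-- The symbol of the bilinear form in the variables `ζ = ξ - η` and `η`. -/
def sym (ζ η : E2) : ℝ :=
  ⟪ζ + η, perp η⟫ * ⟪ζ + η, η - ζ⟫ / (‖ζ + η‖ ^ 2 * (‖η‖ + ‖ζ‖) * ‖ζ‖ * ‖η‖)

theorem norm_sq_eq (x : E2) : ‖x‖ ^ 2 = x 0 * x 0 + x 1 * x 1 := by
  rw [← inner_eq, real_inner_self_eq_norm_sq]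

theorem sym_eq_sub {ζ η : E2} (hζ : ζ ≠ 0) (hη : η ≠ 0) :
    sym ζ η = ⟪ζ, perp η⟫ / (‖ζ + η‖ ^ 2 * ‖ζ‖) - ⟪ζ, perp η⟫ / (‖ζ + η‖ ^ 2 * ‖η‖) := by
  have h1 : (⟪ζ + η, perp η⟫ : ℝ) = ⟪ζ, perp η⟫ := by
    simp only [inner_eq, perp_zero, perp_one, PiLp.add_apply]; ring
  have h2 : (⟪ζ + η, η - ζ⟫ : ℝ) = (‖η‖ - ‖ζ‖) * (‖η‖ + ‖ζ‖) := by
    have : (‖η‖ - ‖ζ‖) * (‖η‖ + ‖ζ‖) = ‖η‖ ^ 2 - ‖ζ‖ ^ 2 := by ring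
    rw [this, norm_sq_eq, norm_sq_eq]
    simp only [inner_eq, PiLp.add_apply, PiLp.sub_apply]; ring
  have a := norm_pos_iff.2 hζ
  have b := norm_pos_iff.2 hη
  rw [sym, h1, h2]
  rcases eq_or_ne (ζ + η) 0 with h | h
  · simp [h]
  · have c := norm_pos_iff.2 h
    field_simp

theorem sym_smul_smul (a b : ℝ) (hb : 0 < b) {ζ η ζ' η' ξ' : E2} (h1 : ζ = b • ζ')
    (h2 : η = b • η') (h3 : ζ + η = a • ξ') (ha : 0 < a) :
    sym ζ η = b⁻¹ * (⟪ξ', perp η'⟫ * ⟪ξ', η' - ζ'⟫ /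
      (‖ξ'‖ ^ 2 * (‖η'‖ + ‖ζ'‖) * ‖ζ'‖ * ‖η'‖)) := by
  have e : perp η = b • perp η' := by
    rw [h2]; ext i; fin_cases i <;> simp [perp]
  rw [sym, h3, e, h1, h2, ← smul_sub]
  simp only [real_inner_smul_left, real_inner_smul_right, norm_smul, Real.norm_eq_abs,
    abs_of_pos ha, abs_of_pos hb]
  rw [show b * (a * ⟪ξ', perp η'⟫) * (b * (a * ⟪ξ', η' - ζ'⟫)) =
      (a ^ 2 * b ^ 2) * (⟪ξ', perp η'⟫ * ⟪ξ', η' - ζ'⟫) by ring,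
    show (a * ‖ξ'‖) ^ 2 * (b * ‖η'‖ + b * ‖ζ'‖) * (b * ‖ζ'‖) * (b * ‖η'‖) =
      (a ^ 2 * b ^ 2 * b) * (‖ξ'‖ ^ 2 * (‖η'‖ + ‖ζ'‖) * ‖ζ'‖ * ‖η'‖) by ring,
    mul_div_mul_comm]
  congr 1
  field_simp

/-- The bilinear form with output localized at frequency `2 ^ j` and Fourier data `u`, `v`. -/
def piece (D : DyadicData) (j : ℤ) (u v : E2 → ℂ) (x : E2) : ℂ :=
  ∫ z : E2 × E2, ((D.Φ ((2 : ℝ) ^ (-j) • (z.1 + z.2)) * sym z.1 z.2 : ℝ) : ℂ) *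
    (phase ⟪x, z.1 + z.2⟫ * (u z.1 * v z.2))

theorem eq_smul_zpow (k : ℤ) (ζ : E2) : ζ = (2 : ℝ) ^ k • ((2 : ℝ) ^ (-k) • ζ) := by
  rw [smul_smul, ← zpow_add₀ two_ne_zero, add_neg_cancel, zpow_zero, one_smul]

theorem enorm_two_zpow (n : ℤ) : ‖(((2 : ℝ) ^ n : ℝ) : ℂ)‖ₑ = (2 : ℝ≥0∞) ^ (n : ℝ) := by
  rw [← ofReal_norm, Complex.norm_real, Real.norm_of_nonneg (by positivity), two_zpow_eq_rpow]

theorem exists_piece_le_same_scale (D : DyadicData) :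
    ∃ C : ℝ≥0∞, C ≠ ⊤ ∧ ∀ (j k : ℤ) (u v : E2 → ℂ), Integrable u → Integrable v →
      (∀ ζ, u ζ ≠ 0 → 1 / 16 ≤ ‖(2 : ℝ) ^ (-k) • ζ‖ ∧ ‖(2 : ℝ) ^ (-k) • ζ‖ ≤ 16) →
      (∀ η, v η ≠ 0 → 1 / 16 ≤ ‖(2 : ℝ) ^ (-k) • η‖ ∧ ‖(2 : ℝ) ^ (-k) • η‖ ≤ 16) →
      ∀ x : E2, ‖piece D j u v x‖ₑ ≤ C * (2 : ℝ≥0∞) ^ (-(k : ℝ)) *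
        avg j (fun y => avg k (fun y => ‖invFT u y‖ₑ) y * avg k (fun y => ‖invFT v y‖ₑ) y) x := by
  have hreg := fun ζ => (regNorm_pos ζ).ne'
  have hh : ∀ i : Fin 2 × Fin 2,
      IsMult (fun ξ => ((D.Φ ξ * (ξ i.1 * ξ i.2 / regNorm ξ ^ 2) : ℝ) : ℂ)) := fun i => by
    refine isMult_Φ_mul D (((contDiff_coord _).mul (contDiff_coord _)).div
      (contDiff_regNorm.pow 2) fun ζ => pow_ne_zero _ (hreg ζ))
  have hM : ∀ i : Fin 2 × Fin 2, IsBiMult (fun ζ η => ((perp η i.1 * (η i.2 - ζ i.2) /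
      (regNorm η * regNorm ζ * (regNorm η + regNorm ζ)) *
        (wideBump ζ * wideBump η) : ℝ) : ℂ)) := fun i => by
    refine isBiMult_wideBump_mul (a := fun z : E2 × E2 => perp z.2 i.1 * (z.2 i.2 - z.1 i.2) /
      (regNorm z.2 * regNorm z.1 * (regNorm z.2 + regNorm z.1))) ?_
    have r1 := contDiff_regNorm.comp (contDiff_fst (𝕜 := ℝ) (E := E2) (F := E2) (n := ∞))
    have r2 := contDiff_regNorm.comp (contDiff_snd (𝕜 := ℝ) (E := E2) (F := E2) (n := ∞))
    refine ContDiff.div (((contDiff_perp_coord _).comp contDiff_snd).mul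
      (((contDiff_coord _).comp contDiff_snd).sub ((contDiff_coord _).comp contDiff_fst)))
      ((r2.mul r1).mul (r2.add r1)) fun z => ?_
    have := regNorm_pos z.1
    have := regNorm_pos z.2
    positivity
  obtain ⟨C, hC, hb⟩ := exists_bilinear_sum_bound hh hM
  refine ⟨C, hC, fun j k u v hu hv hus hvs x => ?_⟩
  refine le_of_eq_of_le ?_ (hb j k k u v hu hv x (fun _ => (((2 : ℝ) ^ (-k) : ℝ) : ℂ)) _ fun i => ?_)
  · rw [piece]
    congr 1
    refine integral_congr_ae (Filter.Eventually.of_forall fun z => ?_)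
    simp only
    rcases eq_or_ne (u z.1) 0 with h1 | h1
    · simp [h1]
    rcases eq_or_ne (v z.2) 0 with h2 | h2
    · simp [h2]
    congr 1
    set ξ' := (2 : ℝ) ^ (-j) • (z.1 + z.2) with hξ'
    rcases eq_or_ne (D.Φ ξ') 0 with h3 | h3
    · simp [h3]
    obtain ⟨a1, a2⟩ := hus _ h1
    obtain ⟨b1, b2⟩ := hvs _ h2
    rw [sym_smul_smul ((2 : ℝ) ^ j) ((2 : ℝ) ^ k) (by positivity) (eq_smul_zpow k z.1)
      (eq_smul_zpow k z.2) (eq_smul_zpow j _) (by positivity), ← hξ']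
    set ζ' := (2 : ℝ) ^ (-k) • z.1
    set η' := (2 : ℝ) ^ (-k) • z.2
    rw [wideBump_eq_one a2, wideBump_eq_one b2, regNorm_eq a1, regNorm_eq b1,
      regNorm_eq (by linarith [(D.hsupp _ h3).1]), ← zpow_neg, ← Finset.mul_sum]
    norm_cast
    rw [Fintype.sum_prod_type]
    simp only [Fin.sum_univ_two, inner_eq, PiLp.sub_apply]
    have p1 : 0 < ‖ζ'‖ := by linarith
    have p2 : 0 < ‖η'‖ := by linarith
    have p3 : 0 < ‖ξ'‖ := by linarith [(D.hsupp _ h3).1]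
    field_simp
    ring
  · rw [enorm_two_zpow]
    push_cast
    exact le_rfl

theorem exists_piece_le (D : DyadicData) :
    ∃ C : ℝ≥0∞, C ≠ ⊤ ∧ ∀ (j k l : ℤ) (u v : E2 → ℂ), Integrable u → Integrable v →
      k ≤ j + 2 → l ≤ j + 2 →
      (∀ ζ, u ζ ≠ 0 → 1 / 16 ≤ ‖(2 : ℝ) ^ (-k) • ζ‖ ∧ ‖(2 : ℝ) ^ (-k) • ζ‖ ≤ 16) →
      (∀ η, v η ≠ 0 → 1 / 16 ≤ ‖(2 : ℝ) ^ (-l) • η‖ ∧ ‖(2 : ℝ) ^ (-l) • η‖ ≤ 16) →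
      ∀ x : E2, ‖piece D j u v x‖ₑ ≤ C * (4 * (2 : ℝ≥0∞) ^ (-(j : ℝ))) *
        avg j (fun y => avg k (fun y => ‖invFT u y‖ₑ) y * avg l (fun y => ‖invFT v y‖ₑ) y) x := by
  have hreg := fun ζ => (regNorm_pos ζ).ne'
  have hh : ∀ i : Bool,
      IsMult (fun ξ => ((D.Φ ξ * (1 / regNorm ξ ^ 2) : ℝ) : ℂ)) := fun i => by
    refine isMult_Φ_mul D (contDiff_const.div
      (contDiff_regNorm.pow 2) fun ζ => pow_ne_zero _ (hreg ζ))
  have hM : ∀ i : Bool, IsBiMult (fun ζ η => ((⟪ζ, perp η⟫ /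
      (bif i then regNorm ζ else regNorm η) * (wideBump ζ * wideBump η) : ℝ) : ℂ)) := fun i => by
    refine isBiMult_wideBump_mul (a := fun z : E2 × E2 => ⟪z.1, perp z.2⟫ /
      (bif i then regNorm z.1 else regNorm z.2)) ?_
    have r1 := contDiff_regNorm.comp (contDiff_fst (𝕜 := ℝ) (E := E2) (F := E2) (n := ∞))
    have r2 := contDiff_regNorm.comp (contDiff_snd (𝕜 := ℝ) (E := E2) (F := E2) (n := ∞))
    have r3 : ContDiff ℝ ∞ (fun z : E2 × E2 => (⟪z.1, perp z.2⟫ : ℝ)) := by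
      simp only [inner_eq]
      exact (((contDiff_coord 0).comp contDiff_fst).mul
        ((contDiff_perp_coord 0).comp contDiff_snd)).add
        (((contDiff_coord 1).comp contDiff_fst).mul
        ((contDiff_perp_coord 1).comp contDiff_snd))
    cases i
    · exact r3.div r2 fun z => hreg _
    · exact r3.div r1 fun z => hreg _
  obtain ⟨C, hC, hb⟩ := exists_bilinear_sum_bound hh hM
  refine ⟨C, hC, fun j k l u v hu hv hk hl hus hvs x => ?_⟩
  refine le_of_eq_of_le ?_ (hb j k l u v hu hv x
    (fun i => ((bif i then (2 : ℝ) ^ (l - 2 * j) else -(2 : ℝ) ^ (k - 2 * j) : ℝ) : ℂ)) _ fun i => ?_)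
  · rw [piece]
    congr 1
    refine integral_congr_ae (Filter.Eventually.of_forall fun z => ?_)
    simp only
    rcases eq_or_ne (u z.1) 0 with h1 | h1
    · simp [h1]
    rcases eq_or_ne (v z.2) 0 with h2 | h2
    · simp [h2]
    congr 1
    rcases eq_or_ne (D.Φ ((2 : ℝ) ^ (-j) • (z.1 + z.2))) 0 with h3 | h3
    · simp only [h3, zero_mul, Complex.ofReal_zero, mul_zero, Finset.sum_const_zero]
    obtain ⟨a1, a2⟩ := hus _ h1
    obtain ⟨b1, b2⟩ := hvs _ h2
    have hz1 : z.1 ≠ 0 := by rintro h; norm_num [h] at a1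
    have hz2 : z.2 ≠ 0 := by rintro h; norm_num [h] at b1
    have c1 := (D.hsupp _ h3).1
    have hz3 : z.1 + z.2 ≠ 0 := by rintro h; norm_num [h] at c1
    have p1 := norm_pos_iff.2 hz1
    have p2 := norm_pos_iff.2 hz2
    have p3 := norm_pos_iff.2 hz3
    have e : ∀ (t : ℝ) (η : E2), perp (t • η) = t • perp η := fun t η => by
      ext i; fin_cases i <;> simp [perp]
    rw [sym_eq_sub hz1 hz2, Fintype.sum_bool, wideBump_eq_one a2, wideBump_eq_one b2]
    simp only [cond_true, cond_false]
    rw [regNorm_eq a1, regNorm_eq b1, regNorm_eq (by linarith)]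
    norm_cast
    simp only [e, real_inner_smul_left, real_inner_smul_right, norm_smul, norm_zpow,
      Real.norm_ofNat]
    rw [zpow_sub₀ two_ne_zero, zpow_sub₀ two_ne_zero, two_mul, zpow_add₀ two_ne_zero,
      zpow_neg, zpow_neg, zpow_neg]
    have q1 : (0 : ℝ) < 2 ^ j := by positivity
    have q2 : (0 : ℝ) < 2 ^ k := by positivity
    have q3 : (0 : ℝ) < 2 ^ l := by positivity
    field_simp
    ring
  · have e4 : 4 * (2 : ℝ≥0∞) ^ (-(j : ℝ)) = 2 ^ ((2 - j : ℤ) : ℝ) := by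
      push_cast
      rw [sub_eq_add_neg, ENNReal.rpow_add _ _ two_ne_zero ENNReal.ofNat_ne_top]
      congr 1
      norm_num
    rw [e4]
    cases i
    · simp only [cond_false, Complex.ofReal_neg, enorm_neg]
      rw [enorm_two_zpow]
      exact ENNReal.rpow_le_rpow_of_exponent_le one_le_two (by norm_cast; lia)
    · simp only [cond_true]
      rw [enorm_two_zpow]
      exact ENNReal.rpow_le_rpow_of_exponent_le one_le_two (by norm_cast; lia)

theorem exists_lpNorm'_avg_mul_le_same_scale {p r : ℝ} (hp : 1 ≤ p) (hr : 2 ≤ r)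
    (hpr : p ≤ r) (hrp : r / 2 ≤ p) :
    ∃ C : ℝ≥0∞, C ≠ ⊤ ∧ ∀ (j k : ℤ) (F G : E2 → ℝ≥0∞), Measurable F → Measurable G →
      lpNorm' p (avg j fun y => avg k F y * avg k G y) ≤
        C * (2 : ℝ≥0∞) ^ ((4 / r - 2 / p) * (j : ℝ) + (4 / p - 4 / r) * (k : ℝ)) *
          (lpNorm' p F * lpNorm' p G) := by
  obtain ⟨C1, hC1, h1⟩ := exists_lpNorm'_avg_le (p := r / 2) (r := p) (by linarith) hrp
  obtain ⟨C2, hC2, h2⟩ := exists_lpNorm'_avg_le hp hpr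
  refine ⟨C1 * (C2 * C2), by finiteness, fun j k F G hF hG => ?_⟩
  have hp0 : p ≠ 0 := by positivity
  have hr0 : r ≠ 0 := by positivity
  have e : (2 : ℝ≥0∞) ^ ((4 / r - 2 / p) * (j : ℝ) + (4 / p - 4 / r) * (k : ℝ)) =
      2 ^ (2 * (1 / (r / 2) - 1 / p) * (j : ℝ)) *
        (2 ^ (2 * (1 / p - 1 / r) * (k : ℝ)) * 2 ^ (2 * (1 / p - 1 / r) * (k : ℝ))) := by
    rw [← ENNReal.rpow_add _ _ two_ne_zero ENNReal.ofNat_ne_top,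
      ← ENNReal.rpow_add _ _ two_ne_zero ENNReal.ofNat_ne_top]
    congr 1
    field_simp
    ring
  have m1 := measurable_avg k hF
  have m2 := measurable_avg k hG
  calc _ ≤ C1 * 2 ^ (2 * (1 / (r / 2) - 1 / p) * (j : ℝ)) *
        (lpNorm' r (avg k F) * lpNorm' r (avg k G)) := by
        refine (h1 j _ (m1.mul m2)).trans ?_
        gcongr
        exact lpNorm'_mul_le (by linarith) m1 m2
    _ ≤ C1 * 2 ^ (2 * (1 / (r / 2) - 1 / p) * (j : ℝ)) *
        ((C2 * 2 ^ (2 * (1 / p - 1 / r) * (k : ℝ)) * lpNorm' p F) *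
          (C2 * 2 ^ (2 * (1 / p - 1 / r) * (k : ℝ)) * lpNorm' p G)) := by
        gcongr
        · exact h2 k F hF
        · exact h2 k G hG
    _ = _ := by rw [e]; ring

theorem exists_lpNorm'_avg_mul_le {p : ℝ} (hp : 1 ≤ p) :
    ∃ C : ℝ≥0∞, C ≠ ⊤ ∧ ∀ (j k l : ℤ) (F G : E2 → ℝ≥0∞), Measurable F → Measurable G →
      lpNorm' p (avg j fun y => avg k F y * avg l G y) ≤
        C * (2 : ℝ≥0∞) ^ (2 / p * (k : ℝ)) * (lpNorm' p F * lpNorm' p G) := by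
  obtain ⟨C1, hC1, h1⟩ := exists_lpNorm'_avg_le hp le_rfl
  have hW := lintegral_wt_ne_top
  have hpp : 0 ≤ (p - 1) / p := div_nonneg (by linarith) (by linarith)
  simp only [sub_self, mul_zero, zero_mul, ENNReal.rpow_zero, mul_one] at h1
  refine ⟨C1 * ((∫⁻ y, wt y) ^ ((p - 1) / p) * C1), by finiteness, fun j k l F G hF hG => ?_⟩
  have m1 := measurable_avg k hF
  have m2 := measurable_avg l hG
  have hp0 : 0 < p := by linarith
  calc _ ≤ C1 * lpNorm' p (fun y => avg k F y * avg l G y) := h1 j _ (m1.mul m2)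
    _ ≤ C1 * lpNorm' p (fun y => ((∫⁻ y, wt y) ^ ((p - 1) / p) * 2 ^ (2 / p * (k : ℝ)) *
          lpNorm' p F) * avg l G y) := by
        gcongr
        refine lpNorm'_mono hp0 fun y => ?_
        gcongr
        exact avg_le_lpNorm' hp k hF y
    _ ≤ C1 * (((∫⁻ y, wt y) ^ ((p - 1) / p) * 2 ^ (2 / p * (k : ℝ)) *
          lpNorm' p F) * (C1 * lpNorm' p G)) := by
        rw [lpNorm'_const_mul hp0 _ m2]
        gcongr
        exact h1 l G hG
    _ = _ := by ring

/-- The interactions of frequency pieces that contribute to the output at frequency `2 ^ j`. -/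
def Admissible (j k l : ℤ) : Prop :=
  (k ≤ l + 3 ∧ l ≤ k + 3 ∧ j ≤ k + 6) ∨ (k ≤ l - 4 ∧ j ≤ l + 2 ∧ l ≤ j + 2) ∨
    (l ≤ k - 4 ∧ j ≤ k + 2 ∧ k ≤ j + 2)

theorem norm_bounds (D : DyadicData) {k : ℤ} {ζ : E2} (h : D.Φ ((2 : ℝ) ^ (-k) • ζ) ≠ 0) :
    (2 : ℝ) ^ (k - 1) ≤ ‖ζ‖ ∧ ‖ζ‖ ≤ (2 : ℝ) ^ (k + 1) := by
  obtain ⟨h1, h2⟩ := D.hsupp _ h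
  rw [norm_smul, norm_zpow, Real.norm_ofNat, zpow_neg] at h1 h2
  have h0 : (0 : ℝ) < 2 ^ k := by positivity
  rw [inv_mul_eq_div, le_div_iff₀ h0] at h1
  rw [inv_mul_eq_div, div_le_iff₀ h0] at h2
  rw [zpow_add₀ two_ne_zero, zpow_sub₀ two_ne_zero]
  constructor
  · norm_num; linarith
  · norm_num; linarith

theorem admissible_of_ne_zero (D : DyadicData) {j k l : ℤ} {ζ η : E2}
    (hj : D.Φ ((2 : ℝ) ^ (-j) • (ζ + η)) ≠ 0) (hk : D.Φ ((2 : ℝ) ^ (-k) • ζ) ≠ 0)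
    (hl : D.Φ ((2 : ℝ) ^ (-l) • η) ≠ 0) : Admissible j k l := by
  obtain ⟨j1, j2⟩ := norm_bounds D hj
  obtain ⟨k1, k2⟩ := norm_bounds D hk
  obtain ⟨l1, l2⟩ := norm_bounds D hl
  have t1 := norm_add_le ζ η
  have t2 := norm_sub_le (ζ + η) η
  have t3 := norm_sub_le (ζ + η) ζ
  rw [add_sub_cancel_right] at t2
  rw [add_sub_cancel_left] at t3
  have key : ∀ {a b : ℤ}, (2 : ℝ) ^ a < 2 ^ b → a < b := fun h =>
    (zpow_lt_zpow_iff_right₀ one_lt_two).1 h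
  have mono : ∀ {a b : ℤ}, a ≤ b → (2 : ℝ) ^ a ≤ 2 ^ b := fun h =>
    zpow_le_zpow_right₀ one_le_two h
  have ex : ∀ (n m : ℤ), (2 : ℝ) ^ (n + m) = 2 ^ n * 2 ^ m := fun n m => zpow_add₀ two_ne_zero n m
  have pos : ∀ n : ℤ, (0 : ℝ) < 2 ^ n := fun n => by positivity
  unfold Admissible
  rcases le_or_gt k (l - 4) with h | h
  · right; left
    have m : (2 : ℝ) ^ (k + 1) ≤ 2 ^ l * 2 ^ (-3 : ℤ) := by rw [← ex]; exact mono (by lia)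
    have a1 : j - 1 < l + 2 := key (by
      have := pos l
      rw [ex] at l2
      rw [ex l 2]
      norm_num at m l2 ⊢
      linarith)
    have a2 : l + (-2) < j + 1 := key (by
      have := pos l
      rw [sub_eq_add_neg, ex] at l1
      rw [ex l (-2)]
      norm_num at m l1 ⊢
      linarith)
    lia
  rcases le_or_gt l (k - 4) with h' | h'
  · right; right
    have m : (2 : ℝ) ^ (l + 1) ≤ 2 ^ k * 2 ^ (-3 : ℤ) := by rw [← ex]; exact mono (by lia)
    have a1 : j - 1 < k + 2 := key (by
      have := pos k
      rw [ex] at k2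
      rw [ex k 2]
      norm_num at m k2 ⊢
      linarith)
    have a2 : k + (-2) < j + 1 := key (by
      have := pos k
      rw [sub_eq_add_neg, ex] at k1
      rw [ex k (-2)]
      norm_num at m k1 ⊢
      linarith)
    lia
  · left
    have m : (2 : ℝ) ^ (l + 1) ≤ 2 ^ k * 2 ^ (4 : ℤ) := by rw [← ex]; exact mono (by lia)
    have a1 : j - 1 < k + 5 := key (by
      have := pos k
      rw [ex] at k2
      rw [ex k 5]
      norm_num at m k2 ⊢
      linarith)
    lia

theorem piece_eq_zero (D : DyadicData) {j k l : ℤ} (h : ¬ Admissible j k l)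
    (f g : SchwartzMap E2 ℂ) (x : E2) : piece D j (locFT D k f) (locFT D l g) x = 0 := by
  rw [piece]
  refine integral_eq_zero_of_ae (Filter.Eventually.of_forall fun z => ?_)
  simp only [Pi.zero_apply, locFT]
  by_cases hj : D.Φ ((2 : ℝ) ^ (-j) • (z.1 + z.2)) = 0
  · simp only [hj, zero_mul, Complex.ofReal_zero]
  by_cases hk : D.Φ ((2 : ℝ) ^ (-k) • z.1) = 0
  · simp only [hk, zero_mul, Complex.ofReal_zero, mul_zero]
  by_cases hl : D.Φ ((2 : ℝ) ^ (-l) • z.2) = 0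
  · simp only [hl, zero_mul, Complex.ofReal_zero, mul_zero]
  exact absurd (admissible_of_ne_zero D hj hk hl) h

theorem locFT_supp (D : DyadicData) {k k' : ℤ} (h1 : k ≤ k' + 3) (h2 : k' ≤ k + 3)
    (f : SchwartzMap E2 ℂ) (ζ : E2) (h : locFT D k f ζ ≠ 0) :
    1 / 16 ≤ ‖(2 : ℝ) ^ (-k') • ζ‖ ∧ ‖(2 : ℝ) ^ (-k') • ζ‖ ≤ 16 := by
  have h0 : D.Φ ((2 : ℝ) ^ (-k) • ζ) ≠ 0 := by
    intro h'
    exact h (by simp only [locFT, h', Complex.ofReal_zero, zero_mul])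
  obtain ⟨a, b⟩ := norm_bounds D h0
  have m1 : (2 : ℝ) ^ (k' + (-4)) ≤ 2 ^ (k - 1) := zpow_le_zpow_right₀ one_le_two (by lia)
  have m2 : (2 : ℝ) ^ (k + 1) ≤ 2 ^ (k' + 4) := zpow_le_zpow_right₀ one_le_two (by lia)
  rw [zpow_add₀ two_ne_zero] at m1
  rw [zpow_add₀ two_ne_zero k'] at m2
  rw [norm_smul, norm_zpow, Real.norm_ofNat, zpow_neg]
  have hp : (0 : ℝ) < 2 ^ k' := by positivity
  rw [inv_mul_eq_div, le_div_iff₀ hp, div_le_iff₀ hp]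
  norm_num at m1 m2
  constructor <;> linarith

/-- The geometric weight `2 ^ (-ε |n|)`. -/
def geom (ε : ℝ) (n : ℤ) : ℝ≥0∞ := 2 ^ (-(ε * |(n : ℝ)|))

theorem two_rpow_mul_le {C N M P : ℝ≥0∞} {s x e₁ e₂ a b : ℝ}
    (hP : P ≤ C * 2 ^ x * (N * M)) (h : s + x ≤ 40 + e₁ + e₂ + a + b) :
    2 ^ s * P ≤ C * 2 ^ (40 : ℝ) * (2 ^ e₁ * 2 ^ e₂) * ((2 ^ a * N) * (2 ^ b * M)) := by
  have h2 : (2 : ℝ≥0∞) ^ s * 2 ^ x ≤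
      2 ^ (40 : ℝ) * 2 ^ e₁ * 2 ^ e₂ * 2 ^ a * 2 ^ b := by
    simp only [← ENNReal.rpow_add _ _ two_ne_zero ENNReal.ofNat_ne_top]
    exact ENNReal.rpow_le_rpow_of_exponent_le one_le_two h
  calc _ ≤ 2 ^ s * (C * 2 ^ x * (N * M)) := by gcongr
    _ = C * (2 ^ s * 2 ^ x) * (N * M) := by ring
    _ ≤ C * (2 ^ (40 : ℝ) * 2 ^ e₁ * 2 ^ e₂ * 2 ^ a * 2 ^ b) * (N * M) := by gcongr
    _ = _ := by ring

theorem lpNorm'_le_of_le_mul {p : ℝ} (hp : 1 ≤ p) {P A : E2 → ℝ≥0∞} {c B : ℝ≥0∞}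
    (hA : Measurable A) (h : ∀ x, P x ≤ c * A x) (hB : lpNorm' p A ≤ B) :
    lpNorm' p P ≤ c * B := by
  have hp0 : 0 < p := by linarith
  refine (lpNorm'_mono hp0 h).trans ?_
  rw [lpNorm'_const_mul hp0 _ hA]
  gcongr

theorem exists_lpNorm'_piece_le {p : ℝ} (hp : 1 ≤ p) (hp4 : p < 4) (D : DyadicData) :
    ∃ ε > 0, ∃ C : ℝ≥0∞, C ≠ ⊤ ∧ ∀ (j k l : ℤ) (f g : SchwartzMap E2 ℂ),
      2 ^ ((2 / p - 1) * (j : ℝ)) *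
          lpNorm' p (fun x => ‖piece D j (locFT D k f) (locFT D l g) x‖ₑ) ≤
        C * (geom ε (l - j) * geom ε (k - l)) *
          ((2 ^ ((2 / p - 1) * (k : ℝ)) * lpNorm' p (fun x => ‖invFT (locFT D k f) x‖ₑ)) *
            (2 ^ ((2 / p - 1) * (l : ℝ)) * lpNorm' p (fun x => ‖invFT (locFT D l g) x‖ₑ))) := by
  have hp0 : 0 < p := by linarith
  obtain ⟨r, hr2, hpr, hrp, hr4⟩ : ∃ r, 2 ≤ r ∧ p ≤ r ∧ r / 2 ≤ p ∧ r < 4 :=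
    ⟨max p 2, le_max_right _ _, le_max_left _ _, by
      rw [div_le_iff₀ two_pos]; exact max_le (by linarith) (by linarith),
      max_lt hp4 (by norm_num)⟩
  have hr0 : 0 < r := by linarith
  obtain ⟨C1, hC1, hS⟩ := exists_piece_le_same_scale D
  obtain ⟨C2, hC2, hT⟩ := exists_piece_le D
  obtain ⟨C3, hC3, hS'⟩ := exists_lpNorm'_avg_mul_le_same_scale hp hr2 hpr hrp
  obtain ⟨C4, hC4, hT'⟩ := exists_lpNorm'_avg_mul_le hp
  have u1 : 2 / p = 2 * (1 / p) := by ring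
  have u2 : 4 / p = 4 * (1 / p) := by ring
  have u3 : 4 / r = 4 * (1 / r) := by ring
  have hu1 : 1 / p ≤ 1 := by rw [div_le_iff₀ hp0]; linarith
  have hu0 : 0 < 1 / p := by positivity
  have hw1 : 1 / r ≤ 1 / 2 := one_div_le_one_div_of_le two_pos hr2
  have hw0 : 1 / 4 < 1 / r := one_div_lt_one_div_of_lt hr0 hr4
  rw [u1]
  rw [u1] at hT'
  rw [u1, u2, u3] at hS'
  generalize 1 / p = u at *
  generalize 1 / r = w at *
  refine ⟨(4 * w - 1) / 2, by linarith, C1 * C3 * 2 ^ (40 : ℝ) + C2 * 4 * C4 * 2 ^ (40 : ℝ),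
    by finiteness, fun j k l f g => ?_⟩
  set ε := (4 * w - 1) / 2 with hε
  have hε0 : 0 < ε := by linarith
  have hε1 : ε ≤ 1 / 2 := by linarith
  have hw : w = (2 * ε + 1) / 4 := by linarith
  clear_value ε
  subst hw
  by_cases hadm : Admissible j k l
  swap
  · simp [piece_eq_zero D hadm, lpNorm', hp0]
  have hui := integrable_locFT D k f
  have hvi := integrable_locFT D l g
  have hFm := (continuous_invFT hui).measurable.enorm
  have hGm := (continuous_invFT hvi).measurable.enorm
  unfold geom
  push_cast
  rcases hadm with ⟨h1, h2, h3⟩ | ⟨h1, h2, h3⟩ | ⟨h1, h2, h3⟩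
  · have hb := lpNorm'_le_of_le_mul hp
      (measurable_avg j ((measurable_avg k hFm).mul (measurable_avg k hGm)))
      (hS j k _ _ hui hvi (locFT_supp D (by lia) (by lia) f)
        (locFT_supp D (by lia) (by lia) g)) (hS' j k _ _ hFm hGm)
    refine (two_rpow_mul_le (C := C1 * C3) (x := -(k : ℝ) +
      ((4 * ((2 * ε + 1) / 4) - 2 * u) * j + (4 * u - 4 * ((2 * ε + 1) / 4)) * k))
      (hb.trans (le_of_eq ?_)) ?_).trans (by gcongr; exact le_self_add)
    · rw [ENNReal.rpow_add (-(k : ℝ)) _ two_ne_zero ENNReal.ofNat_ne_top]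
      ring
    · have c1 : (k : ℝ) ≤ l + 3 := by exact_mod_cast h1
      have c2 : (l : ℝ) ≤ k + 3 := by exact_mod_cast h2
      have c3 : (j : ℝ) ≤ k + 6 := by exact_mod_cast h3
      have d1 : |(l : ℝ) - j| ≤ 15 - (j - k) := by rw [abs_le]; constructor <;> linarith
      have d2 : |(k : ℝ) - l| ≤ 3 := by rw [abs_le]; constructor <;> linarith
      have d3 := mul_le_mul_of_nonneg_left d1 hε0.le
      have d4 := mul_le_mul_of_nonneg_left d2 hε0.le
      nlinarith
  · have hb := lpNorm'_le_of_le_mul hp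
      (measurable_avg j ((measurable_avg k hFm).mul (measurable_avg l hGm)))
      (hT j k l _ _ hui hvi (by lia) (by lia) (locFT_supp D (by lia) (by lia) f)
        (locFT_supp D (by lia) (by lia) g)) (hT' j k l _ _ hFm hGm)
    refine (two_rpow_mul_le (C := C2 * 4 * C4) (x := -(j : ℝ) + 2 * u * k)
      (hb.trans (le_of_eq ?_)) ?_).trans (by gcongr; exact le_add_self)
    · rw [ENNReal.rpow_add (-(j : ℝ)) _ two_ne_zero ENNReal.ofNat_ne_top]
      ring
    · have c1 : (k : ℝ) ≤ l - 4 := by exact_mod_cast h1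
      have c2 : (j : ℝ) ≤ l + 2 := by exact_mod_cast h2
      have c3 : (l : ℝ) ≤ j + 2 := by exact_mod_cast h3
      have d1 : |(l : ℝ) - j| ≤ 2 := by rw [abs_le]; constructor <;> linarith
      have d2 : |(k : ℝ) - l| ≤ l - k := by rw [abs_le]; constructor <;> linarith
      have d3 := mul_le_mul_of_nonneg_left d1 hε0.le
      have d4 := mul_le_mul_of_nonneg_left d2 hε0.le
      nlinarith
  · have hb := lpNorm'_le_of_le_mul hp
      (measurable_avg j ((measurable_avg k hFm).mul (measurable_avg l hGm)))
      (hT j k l _ _ hui hvi (by lia) (by lia) (locFT_supp D (by lia) (by lia) f)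
        (locFT_supp D (by lia) (by lia) g))
        ((congrArg (fun A => lpNorm' p (avg j A)) (mul_comm (avg k _) (avg l _))).le.trans
          (hT' j l k _ _ hGm hFm))
    refine (two_rpow_mul_le (C := C2 * 4 * C4) (x := -(j : ℝ) + 2 * u * l)
      (hb.trans (le_of_eq ?_)) ?_).trans (by gcongr; exact le_add_self)
    · rw [ENNReal.rpow_add (-(j : ℝ)) _ two_ne_zero ENNReal.ofNat_ne_top]
      ring
    · have c1 : (l : ℝ) ≤ k - 4 := by exact_mod_cast h1
      have c2 : (j : ℝ) ≤ k + 2 := by exact_mod_cast h2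
      have c3 : (k : ℝ) ≤ j + 2 := by exact_mod_cast h3
      have d1 : |(l : ℝ) - j| ≤ k - l + 2 := by rw [abs_le]; constructor <;> linarith
      have d2 : |(k : ℝ) - l| ≤ k - l := by rw [abs_le]; constructor <;> linarith
      have d3 := mul_le_mul_of_nonneg_left d1 hε0.le
      have d4 := mul_le_mul_of_nonneg_left d2 hε0.le
      nlinarith

theorem continuous_perp : Continuous perp := by
  unfold perp
  exact (PiLp.continuous_toLp 2 _).comp (by fun_prop)

theorem measurable_sym : Measurable (fun z : E2 × E2 => sym z.1 z.2) := by
  have := continuous_perp.measurable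
  unfold sym
  fun_prop

theorem sym_zero_left (η : E2) : sym 0 η = 0 := by simp [sym]

theorem sym_zero_right (ζ : E2) : sym ζ 0 = 0 := by simp [sym]

theorem norm_perp (η : E2) : ‖perp η‖ = ‖η‖ := by
  rw [← sq_eq_sq₀ (norm_nonneg _) (norm_nonneg _), norm_sq_eq, norm_sq_eq, perp_zero, perp_one]
  ring

theorem abs_sym_le {ζ η : E2} (h : ζ + η ≠ 0) : |sym ζ η| ≤ ‖ζ + η‖⁻¹ := by
  rcases eq_or_ne ζ 0 with rfl | hζ
  · simp [sym_zero_left]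
  rcases eq_or_ne η 0 with rfl | hη
  · simp [sym_zero_right]
  have a := norm_pos_iff.2 hζ
  have b := norm_pos_iff.2 hη
  have c := norm_pos_iff.2 h
  have h1 : |(⟪ζ + η, perp η⟫ : ℝ)| ≤ ‖ζ‖ * ‖η‖ := by
    have : (⟪ζ + η, perp η⟫ : ℝ) = ⟪ζ, perp η⟫ := by
      simp only [inner_eq, perp_zero, perp_one, PiLp.add_apply]; ring
    rw [this]
    exact (abs_real_inner_le_norm _ _).trans_eq (by rw [norm_perp])
  have h2 : |(⟪ζ + η, η - ζ⟫ : ℝ)| ≤ ‖ζ + η‖ * (‖η‖ + ‖ζ‖) :=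
    (abs_real_inner_le_norm _ _).trans (by gcongr; exact norm_sub_le _ _)
  rw [sym, abs_div, abs_mul, abs_of_pos (by positivity : 0 < ‖ζ + η‖ ^ 2 * (‖η‖ + ‖ζ‖) * ‖ζ‖ * ‖η‖),
    div_le_iff₀ (by positivity)]
  refine (mul_le_mul h1 h2 (abs_nonneg _) (by positivity)).trans (le_of_eq ?_)
  field_simp

theorem norm_Φ_mul_sym_le (D : DyadicData) (j : ℤ) (ζ η : E2) :
    ‖((D.Φ ((2 : ℝ) ^ (-j) • (ζ + η)) * sym ζ η : ℝ) : ℂ)‖ ≤ ((2 : ℝ) ^ (j - 1))⁻¹ := by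
  rw [Complex.norm_real, norm_mul, Real.norm_eq_abs, Real.norm_eq_abs]
  rcases eq_or_ne (D.Φ ((2 : ℝ) ^ (-j) • (ζ + η))) 0 with h | h
  · rw [h, abs_zero, zero_mul]; positivity
  have hb := (norm_bounds D h).1
  have h0 : (0 : ℝ) < 2 ^ (j - 1) := by positivity
  have hne : ζ + η ≠ 0 := norm_pos_iff.1 (h0.trans_le hb)
  rw [abs_of_nonneg (D.h0 _)]
  calc _ ≤ 1 * ‖ζ + η‖⁻¹ := mul_le_mul (D.h1 _) (abs_sym_le hne) (abs_nonneg _) zero_le_one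
    _ ≤ _ := by rw [one_mul]; exact inv_anti₀ h0 hb

theorem measurable_Φ_mul_sym (D : DyadicData) (j : ℤ) : Measurable (fun z : E2 × E2 =>
    ((D.Φ ((2 : ℝ) ^ (-j) • (z.1 + z.2)) * sym z.1 z.2 : ℝ) : ℂ)) := by
  have h1 := (continuous_Φ D).measurable
  have h2 := measurable_sym
  fun_prop

theorem integrable_piece (D : DyadicData) (j : ℤ) {u v : E2 → ℂ} (hu : Integrable u)
    (hv : Integrable v) (x : E2) : Integrable (fun z : E2 × E2 =>
      ((D.Φ ((2 : ℝ) ^ (-j) • (z.1 + z.2)) * sym z.1 z.2 : ℝ) : ℂ) *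
        (phase ⟪x, z.1 + z.2⟫ * (u z.1 * v z.2))) :=
  (integrable_phase_mul (hu.mul_prod hv) (by fun_prop)).bdd_mul
    (measurable_Φ_mul_sym D j).aestronglyMeasurable
    (Filter.Eventually.of_forall fun z => norm_Φ_mul_sym_le D j z.1 z.2)

theorem continuous_piece (D : DyadicData) (j : ℤ) {u v : E2 → ℂ} (hu : Integrable u)
    (hv : Integrable v) : Continuous (piece D j u v) := by
  refine continuous_of_dominated (bound := fun z : E2 × E2 =>
    ((2 : ℝ) ^ (j - 1))⁻¹ * ‖u z.1 * v z.2‖) ?_ ?_ ((hu.mul_prod hv).norm.const_mul _) ?_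
  · exact fun x => (integrable_piece D j hu hv x).aestronglyMeasurable
  · refine fun x => Filter.Eventually.of_forall fun z => ?_
    rw [norm_mul, norm_mul (phase _), norm_phase, one_mul]
    gcongr
    exact norm_Φ_mul_sym_le D j z.1 z.2
  · exact Filter.Eventually.of_forall fun z => by fun_prop

theorem DeltaB_eq (D : DyadicData) (f g : SchwartzMap E2 ℂ) (j : ℤ) (x : E2) :
    DeltaB D f g j x = (((2 * Real.pi) ^ 2 : ℝ) : ℂ)⁻¹ *
      ((1 / 2 : ℂ) * piece D j (FT fun x => f x) (FT fun x => g x) x) := by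
  rw [DeltaB]
  congr 1
  set G : E2 × E2 → ℂ := fun z => ((D.Φ ((2 : ℝ) ^ (-j) • (z.1 + z.2)) * sym z.1 z.2 : ℝ) : ℂ) *
    (phase ⟪x, z.1 + z.2⟫ * (FT (fun x => f x) z.1 * FT (fun x => g x) z.2)) with hG
  have hGi : Integrable G := integrable_piece D j (integrable_FT f) (integrable_FT g) x
  have mp : MeasurePreserving (fun z : E2 × E2 => (z.1 - z.2, z.2)) :=
    measurePreserving_sub_prod volume volume
  have e : ∀ ξ : E2, Complex.exp (Complex.I * ((⟪x, ξ⟫ : ℝ) : ℂ)) *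
      ((D.Φ ((2 : ℝ) ^ (-j) • ξ) : ℝ) : ℂ) * BHat f g ξ =
      (1 / 2 : ℂ) * ∫ η, G (ξ - η, η) := by
    intro ξ
    rw [BHat, mul_left_comm, ← integral_const_mul]
    congr 1
    refine integral_congr_ae (Filter.Eventually.of_forall fun η => ?_)
    have e1 : η - (ξ - η) = (2 : ℝ) • η - ξ := by rw [two_smul]; abel
    simp only [hG, sym, sub_add_cancel, e1, phase]
    push_cast
    ring
  simp_rw [e]
  rw [integral_const_mul, piece]
  congr 1
  have h2 : Integrable (fun z : E2 × E2 => G (z.1 - z.2, z.2)) := mp.integrable_comp_of_integrable hGi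
  rw [← integral_prod (fun z : E2 × E2 => G (z.1 - z.2, z.2)) h2]
  have hmap : Measure.map (fun z : E2 × E2 => (z.1 - z.2, z.2)) (volume.prod volume) =
      volume.prod volume := (measurePreserving_sub_prod volume volume).map_eq
  exact (integral_map mp.measurable.aemeasurable (by rw [hmap]; exact hGi.1)).symm.trans
    (by rw [hmap]; rfl)

theorem hasSum_piece_integrand (D : DyadicData) {ζ η : E2} (c : ℂ) :
    HasSum (fun i : ℤ × ℤ => ((D.Φ ((2 : ℝ) ^ (-i.1) • ζ) * D.Φ ((2 : ℝ) ^ (-i.2) • η) : ℝ) : ℂ) *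
      ((sym ζ η : ℂ) * c)) ((sym ζ η : ℂ) * c) := by
  rcases eq_or_ne ζ 0 with rfl | hζ
  · simp [sym_zero_left, hasSum_zero]
  rcases eq_or_ne η 0 with rfl | hη
  · simp [sym_zero_right, hasSum_zero]
  have h1 := D.hsum ζ hζ
  have h2 := D.hsum η hη
  have h3 := h1.mul h2 (h1.summable.mul_of_nonneg h2.summable (fun _ => D.h0 _) fun _ => D.h0 _)
  have h4 := (Complex.hasSum_ofReal.2 h3).mul_right ((sym ζ η : ℂ) * c)
  simpa using h4

theorem tsum_enorm_Φ_le (D : DyadicData) (ζ : E2) :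
    ∑' k : ℤ, ‖(D.Φ ((2 : ℝ) ^ (-k) • ζ) : ℂ)‖ₑ ≤ 1 := by
  rcases eq_or_ne ζ 0 with rfl | hζ
  · have : D.Φ 0 = 0 := by
      by_contra h
      have := (D.hsupp 0 h).1
      norm_num at this
    simp [this]
  · have h1 := D.hsum ζ hζ
    have e : ∀ k : ℤ, ‖(D.Φ ((2 : ℝ) ^ (-k) • ζ) : ℂ)‖ₑ =
        ENNReal.ofReal (D.Φ ((2 : ℝ) ^ (-k) • ζ)) := fun k => by
      rw [← ofReal_norm, Complex.norm_real, Real.norm_of_nonneg (D.h0 _)]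
    simp_rw [e]
    rw [← ENNReal.ofReal_tsum_of_nonneg (fun _ => D.h0 _) h1.summable, h1.tsum_eq,
      ENNReal.ofReal_one]

theorem enorm_piece_le_tsum (D : DyadicData) (f g : SchwartzMap E2 ℂ) (j : ℤ) (x : E2) :
    ‖piece D j (FT fun x => f x) (FT fun x => g x) x‖ₑ ≤
      ∑' i : ℤ × ℤ, ‖piece D j (locFT D i.1 f) (locFT D i.2 g) x‖ₑ := by
  set G : E2 × E2 → ℂ := fun z => ((D.Φ ((2 : ℝ) ^ (-j) • (z.1 + z.2)) * sym z.1 z.2 : ℝ) : ℂ) *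
    (phase ⟪x, z.1 + z.2⟫ * (FT (fun x => f x) z.1 * FT (fun x => g x) z.2)) with hG
  have hGi : Integrable G := integrable_piece D j (integrable_FT f) (integrable_FT g) x
  have e1 : ∀ (i : ℤ × ℤ) (z : E2 × E2),
      ((D.Φ ((2 : ℝ) ^ (-j) • (z.1 + z.2)) * sym z.1 z.2 : ℝ) : ℂ) *
        (phase ⟪x, z.1 + z.2⟫ * (locFT D i.1 f z.1 * locFT D i.2 g z.2)) =
      ((D.Φ ((2 : ℝ) ^ (-i.1) • z.1) * D.Φ ((2 : ℝ) ^ (-i.2) • z.2) : ℝ) : ℂ) * G z := by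
    intro i z
    simp only [hG, locFT]
    push_cast
    ring
  have e2 : ∀ z, ∑' i : ℤ × ℤ,
      ((D.Φ ((2 : ℝ) ^ (-i.1) • z.1) * D.Φ ((2 : ℝ) ^ (-i.2) • z.2) : ℝ) : ℂ) * G z = G z := by
    intro z
    have := (hasSum_piece_integrand D (ζ := z.1) (η := z.2)
      ((D.Φ ((2 : ℝ) ^ (-j) • (z.1 + z.2)) : ℂ) *
        (phase ⟪x, z.1 + z.2⟫ * (FT (fun x => f x) z.1 * FT (fun x => g x) z.2)))).tsum_eq
    have e3 : G z = (sym z.1 z.2 : ℂ) * ((D.Φ ((2 : ℝ) ^ (-j) • (z.1 + z.2)) : ℂ) *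
        (phase ⟪x, z.1 + z.2⟫ * (FT (fun x => f x) z.1 * FT (fun x => g x) z.2))) := by
      simp only [hG]
      push_cast
      ring
    rw [e3]
    exact this
  have hm : ∀ i : ℤ × ℤ, AEStronglyMeasurable (fun z : E2 × E2 =>
      ((D.Φ ((2 : ℝ) ^ (-i.1) • z.1) * D.Φ ((2 : ℝ) ^ (-i.2) • z.2) : ℝ) : ℂ) * G z) := fun i => by
    have h1 := continuous_Φ D
    exact (by fun_prop : Continuous fun z : E2 × E2 => ((D.Φ ((2 : ℝ) ^ (-i.1) • z.1) *
      D.Φ ((2 : ℝ) ^ (-i.2) • z.2) : ℝ) : ℂ)).aestronglyMeasurable.mul hGi.1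
  have hfin : ∑' i : ℤ × ℤ, ∫⁻ z : E2 × E2,
      ‖((D.Φ ((2 : ℝ) ^ (-i.1) • z.1) * D.Φ ((2 : ℝ) ^ (-i.2) • z.2) : ℝ) : ℂ) * G z‖ₑ ≠ ⊤ := by
    rw [← lintegral_tsum fun i => (hm i).enorm]
    refine ne_top_of_le_ne_top hGi.2.ne (lintegral_mono fun z => ?_)
    simp only [Complex.ofReal_mul, enorm_mul]
    rw [ENNReal.tsum_mul_right, ENNReal.tsum_prod (f := fun k l =>
      ‖(D.Φ ((2 : ℝ) ^ (-k) • z.1) : ℂ)‖ₑ * ‖(D.Φ ((2 : ℝ) ^ (-l) • z.2) : ℂ)‖ₑ)]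
    simp_rw [ENNReal.tsum_mul_left, ENNReal.tsum_mul_right]
    calc _ ≤ 1 * 1 * ‖G z‖ₑ := by
          gcongr
          · exact tsum_enorm_Φ_le D z.1
          · exact tsum_enorm_Φ_le D z.2
      _ = _ := by simp
  have h := integral_tsum hm hfin
  simp_rw [e2] at h
  have e4 : ∀ i : ℤ × ℤ, piece D j (locFT D i.1 f) (locFT D i.2 g) x = ∫ z : E2 × E2,
      ((D.Φ ((2 : ℝ) ^ (-i.1) • z.1) * D.Φ ((2 : ℝ) ^ (-i.2) • z.2) : ℝ) : ℂ) * G z := fun i => by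
    rw [piece]
    simp_rw [e1]
  simp_rw [e4]
  rw [piece, h]
  exact enorm_tsum_le_tsum_enorm

theorem tsum_geom_ne_top {ε : ℝ} (hε : 0 < ε) : ∑' n : ℤ, geom ε n ≠ ⊤ := by
  have h1 : (2 : ℝ) ^ (-ε) < 1 := Real.rpow_lt_one_of_one_lt_of_neg one_lt_two (by linarith)
  have hs : Summable fun n : ℕ => (2 : ℝ) ^ (-(ε * (n : ℝ))) := by
    refine (summable_geometric_of_lt_one (by positivity) h1).congr fun n => ?_
    rw [← Real.rpow_natCast, ← Real.rpow_mul (by norm_num), neg_mul]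
  have h2 : Summable fun n : ℤ => (2 : ℝ) ^ (-(ε * |(n : ℝ)|)) := by
    refine summable_int_iff_summable_nat_and_neg.2 ⟨?_, ?_⟩ <;> simpa using hs
  have e : ∀ n : ℤ, geom ε n = ENNReal.ofReal ((2 : ℝ) ^ (-(ε * |(n : ℝ)|))) := fun n => by
    rw [geom, ← ENNReal.ofReal_rpow_of_pos two_pos, ENNReal.ofReal_ofNat]
  simp_rw [e]
  exact h2.tsum_ofReal_ne_top

theorem le_tsum_rpow {q : ℝ} (hq : 0 < q) (a : ℤ → ℝ≥0∞) (k : ℤ) :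
    a k ≤ (∑' n, a n ^ q) ^ (1 / q) := by
  rw [one_div, ENNReal.le_rpow_inv_iff hq]
  exact ENNReal.le_tsum k

theorem tsum_bilinear_rpow_le {q : ℝ} (hq : 1 ≤ q) {κ t a b : ℤ → ℝ≥0∞} {c : ℝ≥0∞}
    (h : ∀ j, t j ≤ ∑' i : ℤ × ℤ, c * (κ (i.2 - j) * κ (i.1 - i.2)) * (a i.1 * b i.2)) :
    (∑' j, t j ^ q) ^ (1 / q) ≤
      c * (∑' n, κ n) ^ 2 * (∑' k, a k ^ q) ^ (1 / q) * (∑' l, b l ^ q) ^ (1 / q) := by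
  have hq0 : 0 < q := by linarith
  set N := (∑' k, a k ^ q) ^ (1 / q) with hN
  set Γ := ∑' n, κ n with hΓ
  have h1 : ∀ j, t j ≤ c * Γ * N * ∑' l, κ (l - j) * b l := fun j => by
    refine (h j).trans ?_
    rw [ENNReal.tsum_prod (f := fun k l => c * (κ (l - j) * κ (k - l)) * (a k * b l)),
      ENNReal.tsum_comm, ← ENNReal.tsum_mul_left]
    refine ENNReal.tsum_le_tsum fun l => ?_
    calc ∑' k, c * (κ (l - j) * κ (k - l)) * (a k * b l)
        ≤ ∑' k, (c * N * (κ (l - j) * b l)) * κ (k - l) := by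
          refine ENNReal.tsum_le_tsum fun k => ?_
          calc c * (κ (l - j) * κ (k - l)) * (a k * b l)
              ≤ c * (κ (l - j) * κ (k - l)) * (N * b l) := by
                gcongr
                exact le_tsum_rpow hq0 a k
            _ = _ := by ring
      _ = c * N * (κ (l - j) * b l) * Γ := by
          rw [ENNReal.tsum_mul_left, hΓ, ← (Equiv.subRight l).tsum_eq κ]
          rfl
      _ = _ := by ring
  calc (∑' j, t j ^ q) ^ (1 / q)
      ≤ ((c * Γ * N) ^ q * (Γ ^ q * ∑' l, b l ^ q)) ^ (1 / q) := by
        gcongr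
        calc ∑' j, t j ^ q ≤ ∑' j, (c * Γ * N) ^ q * (∑' l, κ (l - j) * b l) ^ q := by
              refine ENNReal.tsum_le_tsum fun j => ?_
              rw [← ENNReal.mul_rpow_of_nonneg _ _ hq0.le]
              exact ENNReal.rpow_le_rpow (h1 j) hq0.le
          _ ≤ _ := by
              rw [ENNReal.tsum_mul_left]
              gcongr
              exact tsum_conv_rpow_le hq κ b
    _ = c * Γ ^ 2 * N * (∑' l, b l ^ q) ^ (1 / q) := by
        have hq' : 0 ≤ 1 / q := by positivity
        rw [ENNReal.mul_rpow_of_nonneg _ _ hq', ENNReal.mul_rpow_of_nonneg _ _ hq',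
          ← ENNReal.rpow_mul, ← ENNReal.rpow_mul, mul_one_div_cancel hq0.ne', ENNReal.rpow_one,
          ENNReal.rpow_one]
        ring

theorem eLpNorm_eq_lpNorm' {p : ℝ} (hp : 0 < p) (h : E2 → ℂ) :
    eLpNorm h (ENNReal.ofReal p) volume = lpNorm' p fun x => ‖h x‖ₑ := by
  rw [eLpNorm_eq_lintegral_rpow_enorm_toReal (by simpa using hp) ENNReal.ofReal_ne_top,
    ENNReal.toReal_ofReal hp.le, lpNorm']

theorem lpNorm'_invFT_locFT {p : ℝ} (hp : 0 < p) (D : DyadicData) (k : ℤ) (f : SchwartzMap E2 ℂ) :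
    lpNorm' p (fun x => ‖invFT (locFT D k f) x‖ₑ) = ‖(((2 * Real.pi) ^ 2 : ℝ) : ℂ)‖ₑ *
      eLpNorm (convPhi D k fun x => f x) (ENNReal.ofReal p) volume := by
  rw [eLpNorm_eq_lpNorm' hp,
    ← lpNorm'_const_mul hp _ (continuous_convPhi D k f).measurable.enorm]
  congr 1
  ext x
  rw [← enorm_mul, convPhi_eq, invFT, mul_inv_cancel_left₀]
  simp [Real.pi_ne_zero]

theorem eLpNorm_DeltaB_le {p : ℝ} (hp : 1 ≤ p) (D : DyadicData) (f g : SchwartzMap E2 ℂ) (j : ℤ) :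
    eLpNorm (DeltaB D f g j) (ENNReal.ofReal p) volume ≤
      ‖(((2 * Real.pi) ^ 2 : ℝ) : ℂ)⁻¹ * (1 / 2 : ℂ)‖ₑ * ∑' i : ℤ × ℤ,
        lpNorm' p (fun x => ‖piece D j (locFT D i.1 f) (locFT D i.2 g) x‖ₑ) := by
  have hp0 : 0 < p := by linarith
  have hm : ∀ i : ℤ × ℤ, Measurable fun x => ‖piece D j (locFT D i.1 f) (locFT D i.2 g) x‖ₑ :=
    fun i => (continuous_piece D j (integrable_locFT D i.1 f)
      (integrable_locFT D i.2 g)).measurable.enorm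
  calc eLpNorm (DeltaB D f g j) (ENNReal.ofReal p) volume
      ≤ lpNorm' p (fun x => ‖(((2 * Real.pi) ^ 2 : ℝ) : ℂ)⁻¹ * (1 / 2 : ℂ)‖ₑ *
          ∑' i : ℤ × ℤ, ‖piece D j (locFT D i.1 f) (locFT D i.2 g) x‖ₑ) := by
        rw [eLpNorm_eq_lpNorm' hp0]
        refine lpNorm'_mono hp0 fun x => ?_
        rw [DeltaB_eq, ← mul_assoc, enorm_mul]
        gcongr
        exact enorm_piece_le_tsum D f g j x
    _ ≤ _ := by
        rw [lpNorm'_const_mul hp0 _ (Measurable.tsum hm)]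
        gcongr
        exact lpNorm'_tsum_le hp hm

/-- the key bilinear estimate in `Ḃ^{2/p−1}_{p,q}(ℝ²)` for
`1 ≤ p < 4` and `1 ≤ q < ∞` (Lemma 3.1), restricted to Schwartz inputs. -/
theorem stmt19 (p q : ℝ) (hp1 : 1 ≤ p) (hp4 : p < 4) (hq1 : 1 ≤ q)
    (D : DyadicData) :
    ∃ C : ℝ≥0, 0 < C ∧ ∀ f g : SchwartzMap E2 ℂ,
      (∑' j : ℤ, ((2 : ℝ≥0∞) ^ ((2 / p - 1) * (j : ℝ)) *
          eLpNorm (DeltaB D f g j) (ENNReal.ofReal p) volume) ^ q) ^ (1 / q) ≤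
        (C : ℝ≥0∞) *
          (∑' j : ℤ, ((2 : ℝ≥0∞) ^ ((2 / p - 1) * (j : ℝ)) *
            eLpNorm (convPhi D j (fun x => f x)) (ENNReal.ofReal p) volume) ^ q) ^ (1 / q) *
          (∑' j : ℤ, ((2 : ℝ≥0∞) ^ ((2 / p - 1) * (j : ℝ)) *
            eLpNorm (convPhi D j (fun x => g x)) (ENNReal.ofReal p) volume) ^ q) ^ (1 / q) := by
  obtain ⟨ε, hε, C, hC, h⟩ := exists_lpNorm'_piece_le hp1 hp4 D
  have hp0 : 0 < p := by linarith
  set K : ℝ≥0∞ := ‖(((2 * Real.pi) ^ 2 : ℝ) : ℂ)‖ₑ with hK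
  set c : ℝ≥0∞ := ‖(((2 * Real.pi) ^ 2 : ℝ) : ℂ)⁻¹ * (1 / 2 : ℂ)‖ₑ with hc
  have hfin : c * C * K * K * (∑' n, geom ε n) ^ 2 ≠ ⊤ := by
    have := tsum_geom_ne_top hε
    finiteness
  refine ⟨(c * C * K * K * (∑' n, geom ε n) ^ 2).toNNReal + 1, by positivity, fun f g => ?_⟩
  refine (tsum_bilinear_rpow_le (κ := geom ε) (c := c * C * K * K)
    (a := fun k => (2 : ℝ≥0∞) ^ ((2 / p - 1) * (k : ℝ)) *
      eLpNorm (convPhi D k (fun x => f x)) (ENNReal.ofReal p) volume)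
    (b := fun k => (2 : ℝ≥0∞) ^ ((2 / p - 1) * (k : ℝ)) *
      eLpNorm (convPhi D k (fun x => g x)) (ENNReal.ofReal p) volume) hq1 fun j => ?_).trans ?_
  · refine (mul_le_mul_right (eLpNorm_DeltaB_le hp1 D f g j) _).trans ?_
    rw [mul_left_comm, ← ENNReal.tsum_mul_left, ← ENNReal.tsum_mul_left]
    refine ENNReal.tsum_le_tsum fun i => ?_
    refine (mul_le_mul_right (h j i.1 i.2 f g) _).trans_eq ?_
    rw [lpNorm'_invFT_locFT hp0, lpNorm'_invFT_locFT hp0, ← hK]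
    ring
  · rw [ENNReal.coe_add, ENNReal.coe_toNNReal hfin]
    gcongr
    exact le_self_add
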